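/- For every ε > 0 there exists d₀ ∈ ℕ such that for every finite group Γ and every subset S ⊆ Γ with |S| = d ≥ d₀, there exists an ordering s_1, ..., s_d of the elements of S such that the number of distinct values among the partial products s_1, s_1s_2, ..., s_1s_2⋯s_d is at least (1−ε)d. -/

import Mathlib

/-- The `t`-th partial product `σ 0 * σ 1 * ⋯ * σ t` of an ordering `σ`. -/
def partialProd {Γ : Type*} [Group Γ] {d : ℕ} (σ : Fin d → Γ) (t : Fin d) : Γ :=
  ((List.ofFn σ).take (t.1 + 1)).prod

section aux
open Finset
set_option linter.unusedSectionVars false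



section basics
variable {Γ : Type} [Group Γ]

/-- vertices of the walk from `x` along `w` (start excluded) -/
def vl : Γ → List Γ → List Γ
  | _, [] => []
  | x, s :: w => (x * s) :: vl (x * s) w

@[simp] lemma vl_nil (x : Γ) : vl x [] = [] := rfl
@[simp] lemma vl_cons (x s : Γ) (w : List Γ) : vl x (s :: w) = (x * s) :: vl (x * s) w := rfl

lemma vl_append (x : Γ) (a b : List Γ) : vl x (a ++ b) = vl x a ++ vl (x * a.prod) b := by
  induction a generalizing x with
  | nil => simp
  | cons s a ih => simp [ih, mul_assoc]

lemma vl_length (x : Γ) (w : List Γ) : (vl x w).length = w.length := by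
  induction w generalizing x with
  | nil => simp
  | cons s a ih => simp [ih]

lemma vl_translate (g x : Γ) (w : List Γ) : vl (g * x) w = (vl x w).map (g * ·) := by
  induction w generalizing x with
  | nil => simp
  | cons s a ih => simp [mul_assoc, ih]

lemma vl_getElem (x : Γ) (w : List Γ) (t : ℕ) (h : t < (vl x w).length) :
    (vl x w)[t] = x * (w.take (t + 1)).prod := by
  induction w generalizing x t with
  | nil => simp at h
  | cons s a ih =>
    cases t with
    | zero => simp
    | succ t => simp [ih, mul_assoc]

variable [DecidableEq Γ]

/-- number of edges leaving `X` with colours in `R` -/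
def bd (R X : Finset Γ) : ℕ := ∑ s ∈ R, #{x ∈ X | x * s ∉ X}

lemma card_in_eq (s : Γ) (X : Finset Γ) :
    #{x ∈ X | x * s ∈ X} = #{x ∈ X | x * s⁻¹ ∈ X} := by
  apply Finset.card_bij (fun x _ => x * s)
  · intro a ha; simp at ha ⊢; exact ⟨ha.2, ha.1⟩
  · intro a _ b _ h; simpa using h
  · intro b hb; simp at hb; exact ⟨b * s⁻¹, by simp [hb], by simp⟩

lemma card_out_eq (s : Γ) (X : Finset Γ) :
    #{x ∈ X | x * s ∉ X} = #{x ∈ X | x * s⁻¹ ∉ X} := by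
  have h1 := Finset.card_filter_add_card_filter_not (s := X) (fun x => x * s ∈ X)
  have h2 := Finset.card_filter_add_card_filter_not (s := X) (fun x => x * s⁻¹ ∈ X)
  have h3 := card_in_eq s X
  omega

lemma bd_inv (R X : Finset Γ) : bd R X = ∑ s ∈ R, #{x ∈ X | x * s⁻¹ ∉ X} :=
  Finset.sum_congr rfl fun s _ => card_out_eq s X

lemma bd_mono {R R' X : Finset Γ} (h : R ⊆ R') : bd R X ≤ bd R' X :=
  Finset.sum_le_sum_of_subset h

end basics

section escape
variable {Γ : Type} [Group Γ] [Fintype Γ] [DecidableEq Γ]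

/-- distribution of the random walk -/
noncomputable def PP (R : Finset Γ) : ℕ → Γ → ℝ
  | 0, z => if z = 1 then 1 else 0
  | j + 1, z => (∑ s ∈ R, PP R j (z * s⁻¹)) / #R

lemma PP_succ (R : Finset Γ) (j : ℕ) (z : Γ) :
    PP R (j+1) z = (∑ s ∈ R, PP R j (z * s⁻¹)) / #R := rfl

lemma PP_nonneg (R : Finset Γ) (j : ℕ) (z : Γ) : 0 ≤ PP R j z := by
  induction j generalizing z with
  | zero => simp only [PP]; split_ifs <;> norm_num
  | succ j ih => rw [PP_succ]; exact div_nonneg (Finset.sum_nonneg fun s _ => ih _) (by positivity)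

lemma PP_sum (R : Finset Γ) (hR : R.Nonempty) (j : ℕ) : ∑ z, PP R j z = 1 := by
  induction j with
  | zero => simp [PP]
  | succ j ih =>
    simp only [PP_succ]
    rw [← Finset.sum_div, Finset.sum_comm]
    have : ∀ s ∈ R, ∑ z, PP R j (z * s⁻¹) = 1 := by
      intro s _
      rw [← ih]
      exact Fintype.sum_equiv (Equiv.mulRight s⁻¹) _ _ (fun x => rfl)
    rw [Finset.sum_congr rfl this]
    have : (#R : ℝ) ≠ 0 := by simpa using hR.ne_empty
    simp [this]

lemma PP_le (R : Finset Γ) (hR : R.Nonempty) (j : ℕ) (z : Γ) : PP R (j+1) z ≤ 1 / #R := by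
  rw [PP_succ]
  gcongr
  rw [← PP_sum R hR j]
  calc ∑ s ∈ R, PP R j (z * s⁻¹) = ∑ y ∈ R.image (fun s => z * s⁻¹), PP R j y := by
        rw [Finset.sum_image]; intro a _ b _ h; simpa using h
    _ ≤ _ := Finset.sum_le_sum_of_subset_of_nonneg (Finset.subset_univ _)
        (fun i _ _ => PP_nonneg R j i)

lemma PP_left (R : Finset Γ) (j : ℕ) (z : Γ) :
    PP R (j+1) z = (∑ s ∈ R, PP R j (s⁻¹ * z)) / #R := by
  induction j generalizing z with
  | zero =>
    rw [PP_succ]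
    refine congrArg (· / (#R : ℝ)) (Finset.sum_congr rfl ?_)
    intro s _
    show (if z * s⁻¹ = 1 then (1:ℝ) else 0) = if s⁻¹ * z = 1 then 1 else 0
    have : z * s⁻¹ = 1 ↔ s⁻¹ * z = 1 := by
      rw [mul_inv_eq_one, inv_mul_eq_one, eq_comm]
    simp [this]
  | succ j ih =>
    rw [PP_succ, Finset.sum_congr rfl (fun s _ => ih (z * s⁻¹)),
      Finset.sum_congr rfl (fun s _ => PP_succ R j (s⁻¹ * z))]
    rw [← Finset.sum_div, ← Finset.sum_div, Finset.sum_comm]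
    simp only [mul_assoc]

noncomputable def nu (R : Finset Γ) (K : ℕ) (z : Γ) : ℝ := (∑ j ∈ range K, PP R (j+1) z) / K

lemma nu_nonneg (R : Finset Γ) (K : ℕ) (z : Γ) : 0 ≤ nu R K z :=
  div_nonneg (Finset.sum_nonneg fun s _ => PP_nonneg _ _ _) (by positivity)

lemma nu_sum (R : Finset Γ) (hR : R.Nonempty) (K : ℕ) (hK : 0 < K) : ∑ z, nu R K z = 1 := by
  unfold nu
  rw [← Finset.sum_div, Finset.sum_comm]
  simp only [PP_sum R hR]
  simp [hK.ne']

lemma nu_harm (R : Finset Γ) (hR : R.Nonempty) (K : ℕ) (hK : 0 < K) (z : Γ) :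
    #R * nu R K z - 1 / K ≤ ∑ s ∈ R, nu R K (z * s⁻¹) := by
  have hR' : (0:ℝ) < #R := by exact_mod_cast hR.card_pos
  have hK' : (0:ℝ) < K := by exact_mod_cast hK
  have h1 : ∑ s ∈ R, nu R K (z * s⁻¹) = (∑ j ∈ range K, #R * PP R (j+2) z) / K := by
    unfold nu
    rw [← Finset.sum_div, Finset.sum_comm]
    congr 1
    apply Finset.sum_congr rfl
    intro j _
    rw [PP_succ R (j+1)]; field_simp
  have h2 : ∑ j ∈ range K, PP R (j+2) z = ∑ j ∈ range K, PP R (j+1) z + PP R (K+1) z - PP R 1 z := by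
    have a := Finset.sum_range_succ (fun j => PP R (j+1) z) K
    have b := Finset.sum_range_succ' (fun j => PP R (j+1) z) K
    simp only [zero_add] at b
    have : ∑ j ∈ range K, PP R (j+2) z = ∑ j ∈ range K, PP R (j+1+1) z := rfl
    linarith
  rw [h1, ← Finset.mul_sum, h2]
  have h3 := PP_le R hR 0 z
  have h4 := PP_nonneg R (K+1) z
  unfold nu
  rw [mul_div_assoc', div_sub_div_same, div_le_div_iff_of_pos_right hK']
  have : #R * PP R (0+1) z ≤ 1 := by
    calc #R * PP R (0+1) z ≤ #R * (1 / #R) := by gcongr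
      _ = 1 := by field_simp
  simp only [zero_add] at this
  nlinarith [mul_nonneg hR'.le h4]

end escape

lemma escape (η c : ℝ) (hη : 0 < η) (hη1 : η ≤ 1) (hc : 0 < c) :
    ∃ K : ℕ, 0 < K ∧ ∀ (Γ : Type) [Group Γ] [Fintype Γ] [DecidableEq Γ] (R : Finset Γ),
      R.Nonempty → (∀ X : Finset Γ, X.Nonempty → (#X : ℝ) ≤ c * #R → η * #R * #X < bd R X) →
      ∀ z, nu R K z ≤ 2 / (c * #R) := by
  obtain ⟨J, hJ⟩ : ∃ J : ℕ, 2 * c < (1 + η/2) ^ J := pow_unbounded_of_one_lt _ (by linarith)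
  -- levels 0..J+1
  set θ : ℕ → ℝ := fun j => (η/4)^(J+1-j) / 2 with hθ
  have hθpos : ∀ j, 0 < θ j := fun j => by simp only [hθ]; positivity
  have hθle : ∀ j, θ j ≤ 1/2 := fun j => by
    simp only [hθ]
    have : (η/4)^(J+1-j) ≤ 1 := pow_le_one₀ (by positivity) (by linarith)
    linarith
  have hθs : ∀ j, j ≤ J → θ j = η/4 * θ (j+1) := fun j hj => by
    simp only [hθ]
    rw [show J+1-j = (J+1-(j+1)) + 1 by omega, pow_succ]; ring
  obtain ⟨K, hK⟩ := exists_nat_gt (c / (2 * θ 0))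
  have hK0 : 0 < K := by
    have : (0:ℝ) < K := lt_trans (by have := hθpos 0; positivity) hK
    exact_mod_cast this
  refine ⟨K, hK0, ?_⟩
  intro Γ _ _ _ R hR hX z0
  by_contra hz0
  push Not at hz0
  have hR' : (0:ℝ) < #R := by exact_mod_cast hR.card_pos
  have hK' : (0:ℝ) < K := by exact_mod_cast hK0
  obtain ⟨zm, -, hzm⟩ := Finset.exists_max_image (Finset.univ : Finset Γ) (nu R K) ⟨1, by simp⟩
  set M := nu R K zm with hM
  have hMle : ∀ z, nu R K z ≤ M := fun z => hzm z (by simp)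
  have hMbig : 2 / (c * #R) < M := lt_of_lt_of_le hz0 (hMle _)
  have hMpos : 0 < M := lt_trans (by positivity) hMbig
  have hKM : 1 / (K:ℝ) ≤ #R * (θ 0 * M) := by
    have h1 : 2 < M * (c * #R) := by rwa [div_lt_iff₀ (by positivity)] at hMbig
    have h2 : c < K * (2 * θ 0) := by rwa [div_lt_iff₀ (by have := hθpos 0; positivity)] at hK
    rw [div_le_iff₀ hK']
    have h3 : 0 < #R * M := by positivity
    nlinarith
  let X : ℕ → Finset Γ := fun j => univ.filter fun z => (1 - θ j) * M ≤ nu R K z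
  have hXmem : ∀ j z, z ∈ X j ↔ (1 - θ j) * M ≤ nu R K z := by intro j z; simp [X]
  have hzX : ∀ j, zm ∈ X j := by
    intro j; rw [hXmem]; have := hθpos j; nlinarith
  have hXcard : ∀ j, (#(X j) : ℝ) < c * #R := by
    intro j
    have h1 : #(X j) * (M/2) ≤ 1 := by
      rw [← nu_sum R hR K hK0]
      calc #(X j) * (M/2) = ∑ z ∈ X j, M/2 := by simp
        _ ≤ ∑ z ∈ X j, nu R K z := Finset.sum_le_sum fun z hz => by
            rw [hXmem] at hz; have := hθle j; nlinarith
        _ ≤ _ := Finset.sum_le_sum_of_subset_of_nonneg (Finset.subset_univ _)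
            (fun i _ _ => nu_nonneg R K i)
    have h2 : 2 < M * (c * #R) := by rwa [div_lt_iff₀ (by positivity)] at hMbig
    by_contra hcon
    push Not at hcon
    nlinarith
  have hθmono : ∀ j ≤ J, θ 0 ≤ θ j := by
    intro j hj
    simp only [hθ]
    have : (η/4)^(J+1-0) ≤ (η/4)^(J+1-j) := pow_le_pow_of_le_one (by positivity) (by linarith) (by omega)
    linarith
  -- key step
  have hstep : ∀ j ≤ J, ∀ x ∈ X j, (#{s ∈ R | x * s⁻¹ ∉ X (j+1)} : ℝ) ≤ η/2 * #R := by
    intro j hj x hx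
    rw [hXmem] at hx
    have h1 := nu_harm R hR K hK0 x
    have h2 : ∑ s ∈ R, (M - nu R K (x * s⁻¹)) ≤ 2 * #R * (θ j * M) := by
      rw [Finset.sum_sub_distrib, Finset.sum_const, nsmul_eq_mul]
      have h3 : #R * (θ 0 * M) ≤ #R * (θ j * M) := by gcongr; exact hθmono j hj
      nlinarith
    have h3 : #{s ∈ R | x * s⁻¹ ∉ X (j+1)} * (θ (j+1) * M) ≤ ∑ s ∈ R, (M - nu R K (x * s⁻¹)) := by
      calc _ = ∑ s ∈ R with x * s⁻¹ ∉ X (j+1), (θ (j+1) * M) := by simp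
        _ ≤ ∑ s ∈ R with x * s⁻¹ ∉ X (j+1), (M - nu R K (x * s⁻¹)) := by
            apply Finset.sum_le_sum
            intro s hs
            rw [Finset.mem_filter, hXmem] at hs
            have := hs.2
            push Not at this
            linarith
        _ ≤ _ := Finset.sum_le_sum_of_subset_of_nonneg (Finset.filter_subset _ _)
            (fun i _ _ => by have := hMle (x * i⁻¹); linarith)
    rw [hθs j hj] at h2
    have h4 := hθpos (j+1)
    have h5 : 0 < θ (j+1) * M := by positivity
    have h6 : #{s ∈ R | x * s⁻¹ ∉ X (j+1)} * (θ (j+1) * M) ≤ (η/2 * #R) * (θ (j+1) * M) := by linarith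
    exact le_of_mul_le_mul_right h6 h5
  have hXmono : ∀ j ≤ J, X j ⊆ X (j+1) := by
    intro j hj z hz
    rw [hXmem] at hz ⊢
    have h1 := hθs j hj
    have h2 := hθpos (j+1)
    have : θ j ≤ θ (j+1) := by rw [h1]; nlinarith
    nlinarith
  have hgrow : ∀ j ≤ J, (1 + η/2) * #(X j) < #(X (j+1)) := by
    intro j hj
    by_contra hcon
    push Not at hcon
    have h1 := hX (X j) ⟨zm, hzX j⟩ (hXcard j).le
    have h2 : (bd R (X j) : ℝ) ≤ η * #R * #(X j) := by
      have h3 : bd R (X j) ≤ ∑ x ∈ X j, #{s ∈ R | x * s⁻¹ ∉ X (j+1)} + #R * #(X (j+1) \ X j) := by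
        rw [bd_inv]
        have h4 : ∑ x ∈ X j, #{s ∈ R | x * s⁻¹ ∉ X (j+1)} = ∑ s ∈ R, #{x ∈ X j | x * s⁻¹ ∉ X (j+1)} :=
          Finset.sum_card_bipartiteAbove_eq_sum_card_bipartiteBelow (fun x s => x * s⁻¹ ∉ X (j+1))
        rw [h4, ← smul_eq_mul, ← Finset.sum_const, ← Finset.sum_add_distrib]
        apply Finset.sum_le_sum
        intro s _
        have h5 : #{x ∈ X j | x * s⁻¹ ∈ X (j+1) \ X j} ≤ #(X (j+1) \ X j) := by
          apply Finset.card_le_card_of_injOn (fun x => x * s⁻¹)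
          · intro a ha; simp at ha ⊢; exact ha.2
          · intro a _ b _ h; simpa using h
        calc #{x ∈ X j | x * s⁻¹ ∉ X j}
            ≤ #({x ∈ X j | x * s⁻¹ ∉ X (j+1)} ∪ {x ∈ X j | x * s⁻¹ ∈ X (j+1) \ X j}) := by
              apply Finset.card_le_card
              intro a ha
              simp only [mem_filter, mem_union, mem_sdiff] at ha ⊢
              tauto
          _ ≤ _ := (Finset.card_union_le _ _).trans (by omega)
      have h6 : (∑ x ∈ X j, #{s ∈ R | x * s⁻¹ ∉ X (j+1)} : ℝ) ≤ #(X j) * (η/2 * #R) := by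
        rw [← nsmul_eq_mul, ← Finset.sum_const]
        exact Finset.sum_le_sum fun x hx => hstep j hj x hx
      have h7 : (#(X (j+1) \ X j) : ℝ) = #(X (j+1)) - #(X j) := by
        rw [Finset.card_sdiff_of_subset (hXmono j hj), Nat.cast_sub (Finset.card_le_card (hXmono j hj))]
      have h8 : (bd R (X j) : ℝ) ≤ (∑ x ∈ X j, #{s ∈ R | x * s⁻¹ ∉ X (j+1)} : ℝ) + #R * #(X (j+1) \ X j) := by
        exact_mod_cast h3
      rw [h7] at h8
      nlinarith
    linarith
  have hX1 : (#R : ℝ) / 2 ≤ #(X 1) := by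
    have h1 := hstep 0 (Nat.zero_le _) zm (hzX 0)
    have h2 := Finset.card_filter_add_card_filter_not (s := R) (fun s => zm * s⁻¹ ∈ X (0+1))
    have h3 : #{s ∈ R | zm * s⁻¹ ∈ X (0+1)} ≤ #(X 1) := by
      apply Finset.card_le_card_of_injOn (fun s => zm * s⁻¹)
      · intro a ha; simp at ha ⊢; exact ha.2
      · intro a _ b _ h; simpa using h
    have h4 : (#R : ℝ) ≤ #(X 1) + #{s ∈ R | zm * s⁻¹ ∉ X (0+1)} := by
      exact_mod_cast (by omega : #R ≤ #(X 1) + #{s ∈ R | zm * s⁻¹ ∉ X (0+1)})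
    nlinarith
  have hfin : ∀ j ≤ J, (1 + η/2)^j * (#R / 2 : ℝ) ≤ #(X (j+1)) := by
    intro j
    induction j with
    | zero => intro _; simpa using hX1
    | succ j ih =>
      intro hj
      have h1 := ih (by omega)
      have h2 := hgrow (j+1) hj
      rw [pow_succ]
      nlinarith
  have h1 := hfin J le_rfl
  have h2 := hXcard (J+1)
  nlinarith



section block
variable {Γ : Type} [Group Γ] [Fintype Γ] [DecidableEq Γ]

noncomputable def hh (R : Finset Γ) (φ : Γ → ℝ) : ℕ → Γ → ℝ
  | 0, _ => 0
  | j + 1, x => (∑ s ∈ R, (φ (x * s) + hh R φ j (x * s))) / #R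

lemma hh_succ (R : Finset Γ) (φ : Γ → ℝ) (j : ℕ) (x : Γ) :
    hh R φ (j+1) x = (∑ s ∈ R, (φ (x * s) + hh R φ j (x * s))) / #R := rfl

lemma hh_nonneg (R : Finset Γ) (φ : Γ → ℝ) (hφ : ∀ x, 0 ≤ φ x) (j : ℕ) (x : Γ) :
    0 ≤ hh R φ j x := by
  induction j generalizing x with
  | zero => exact le_rfl
  | succ j ih =>
    rw [hh_succ]
    exact div_nonneg (Finset.sum_nonneg fun s _ => add_nonneg (hφ _) (ih _)) (by positivity)

lemma PP_conv (R : Finset Γ) (φ : Γ → ℝ) (j : ℕ) (x : Γ) :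
    (∑ s ∈ R, ∑ y, PP R j y * φ (x * s * y)) / #R = ∑ y, PP R (j+1) y * φ (x * y) := by
  have h : ∀ s ∈ R, ∑ y, PP R j y * φ (x * s * y) = ∑ y, PP R j (s⁻¹ * y) * φ (x * y) := by
    intro s _
    refine Fintype.sum_equiv (Equiv.mulLeft s) _ _ (fun y => ?_)
    simp [mul_assoc]
  rw [Finset.sum_congr rfl h, Finset.sum_comm, Finset.sum_div]
  refine Finset.sum_congr rfl fun y _ => ?_
  rw [PP_left, ← Finset.sum_mul]; ring

lemma hh_eq (R : Finset Γ) (φ : Γ → ℝ) (j : ℕ) (x : Γ) :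
    hh R φ j x = ∑ i ∈ range j, ∑ y, PP R (i+1) y * φ (x * y) := by
  induction j generalizing x with
  | zero => simp [hh]
  | succ j ih =>
    rw [hh_succ, Finset.sum_add_distrib, add_div, Finset.sum_range_succ', add_comm]
    congr 1
    · rw [Finset.sum_congr rfl (fun s _ => ih (x * s)), Finset.sum_comm, Finset.sum_div]
      exact Finset.sum_congr rfl fun i _ => PP_conv R φ (i+1) x
    · rw [← PP_conv R φ 0 x]
      simp [PP]

lemma hh_le (R : Finset Γ) (φ : Γ → ℝ) (hφ : ∀ x, 0 ≤ φ x) (K : ℕ) (hK : 0 < K) (β : ℝ)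
    (hβ : ∀ z, nu R K z ≤ β) (x : Γ) : hh R φ K x ≤ K * β * ∑ y, φ y := by
  have hK' : (0:ℝ) < K := by exact_mod_cast hK
  rw [hh_eq, Finset.sum_comm]
  have h1 : ∑ y, φ y = ∑ y, φ (x * y) :=
    (Fintype.sum_equiv (Equiv.mulLeft x) _ _ (fun y => rfl)).symm
  rw [h1, Finset.mul_sum]
  refine Finset.sum_le_sum fun y _ => ?_
  rw [← Finset.sum_mul]
  refine mul_le_mul_of_nonneg_right ?_ (hφ _)
  have := hβ y
  unfold nu at this
  rw [div_le_iff₀ hK'] at this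
  linarith

lemma block_aux (R : Finset Γ) (φ : Γ → ℝ) (hφ : ∀ x, 0 ≤ φ x) (B : ℕ) (δ : ℝ) (hδ : 0 < δ)
    (hB : B < #R) (hδR : (#R : ℝ) ≤ (1 + δ) * (#R - B)) (j : ℕ) :
    ∀ (F Y : Finset Γ) (x : Γ), #F + #Y + 2 * j ≤ B →
      ∃ w : List Γ, w.length = j ∧ w.Nodup ∧ (∀ s ∈ w, s ∈ R ∧ s ∉ F) ∧ (vl x w).Nodup ∧
        (∀ v ∈ vl x w, v ∉ Y) ∧ ((vl x w).map φ).sum ≤ (1 + δ)^j * hh R φ j x := by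
  induction j with
  | zero => intro F Y x _; exact ⟨[], by simp [hh]⟩
  | succ j ih =>
    intro F Y x hFY
    set g : Γ → ℝ := fun s => φ (x * s) + hh R φ j (x * s) with hg
    have hg0 : ∀ s, 0 ≤ g s := fun s => add_nonneg (hφ _) (hh_nonneg R φ hφ j _)
    set A := {s ∈ R | s ∉ F ∧ x * s ∉ Y} with hA
    have hAc : #R ≤ #A + B := by
      have h1 : R ⊆ A ∪ (F ∪ Y.image (fun y => x⁻¹ * y)) := by
        intro s hs
        by_cases h1 : s ∈ F
        · simp [h1]
        by_cases h2 : x * s ∈ Y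
        · simp only [mem_union, mem_image]; right; right; exact ⟨x * s, h2, by simp⟩
        · simp [hA, hs, h1, h2]
      have h2 := (Finset.card_le_card h1).trans (Finset.card_union_le _ _)
      have h3 := Finset.card_union_le F (Y.image (fun y => x⁻¹ * y))
      have h4 : #(Y.image (fun y => x⁻¹ * y)) ≤ #Y := Finset.card_image_le
      omega
    have hAne : A.Nonempty := by
      rw [← Finset.card_pos]; omega
    have hApos : (0:ℝ) < #A := by exact_mod_cast hAne.card_pos
    have hRpos : (0:ℝ) < #R := by exact_mod_cast (by omega : 0 < #R)
    obtain ⟨s, hsA, hs⟩ : ∃ s ∈ A, g s ≤ (1 + δ) * hh R φ (j+1) x := by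
      by_contra hcon
      push Not at hcon
      have h1 : ∑ s ∈ A, ((1 + δ) * hh R φ (j+1) x) < ∑ s ∈ A, g s :=
        Finset.sum_lt_sum_of_nonempty hAne hcon
      have h2 : ∑ s ∈ A, g s ≤ ∑ s ∈ R, g s :=
        Finset.sum_le_sum_of_subset_of_nonneg (Finset.filter_subset _ _) (fun i _ _ => hg0 i)
      have h3 : ∑ s ∈ R, g s = #R * hh R φ (j+1) x := by rw [hh_succ]; field_simp; rfl
      rw [Finset.sum_const, nsmul_eq_mul] at h1
      have h4 : (#R : ℝ) - B ≤ #A := by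
        have : (#R : ℝ) ≤ #A + B := by exact_mod_cast hAc
        linarith
      have h5 := hh_nonneg R φ hφ (j+1) x
      have h6 : (#R:ℝ) ≤ (1+δ) * #A := by nlinarith
      nlinarith
    simp only [hA, mem_filter] at hsA
    obtain ⟨w, hw1, hw2, hw3, hw4, hw5, hw6⟩ := ih (insert s F) (insert (x * s) Y) (x * s) (by
      have := Finset.card_insert_le s F
      have := Finset.card_insert_le (x * s) Y
      omega)
    refine ⟨s :: w, by simp [hw1], ?_, ?_, ?_, ?_, ?_⟩
    · rw [List.nodup_cons]; exact ⟨fun h => (hw3 s h).2 (by simp), hw2⟩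
    · intro t ht
      rcases List.mem_cons.1 ht with rfl | ht
      · exact ⟨hsA.1, hsA.2.1⟩
      · exact ⟨(hw3 t ht).1, fun h => (hw3 t ht).2 (by simp [h])⟩
    · rw [vl_cons, List.nodup_cons]; exact ⟨fun h => hw5 _ h (by simp), hw4⟩
    · intro v hv
      rw [vl_cons] at hv
      rcases List.mem_cons.1 hv with rfl | hv
      · exact hsA.2.2
      · exact fun h => hw5 v hv (by simp [h])
    · rw [vl_cons, List.map_cons, List.sum_cons]
      have h1 : φ (x * s) ≤ (1 + δ)^j * φ (x * s) :=
        le_mul_of_one_le_left (hφ _) (one_le_pow₀ (by linarith))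
      calc φ (x * s) + ((vl (x * s) w).map φ).sum ≤ (1 + δ)^j * g s := by
            simp only [hg]; rw [mul_add]; linarith
        _ ≤ (1 + δ)^j * ((1 + δ) * hh R φ (j+1) x) := by gcongr
        _ = _ := by ring

lemma block (R : Finset Γ) (K : ℕ) (hK : 0 < K) (hR : 2 * K * (K+1) ≤ #R) (β : ℝ)
    (hβ : ∀ z, nu R K z ≤ β) (φ : Γ → ℝ) (hφ : ∀ x, 0 ≤ φ x) (x : Γ) :
    ∃ w : List Γ, w.length = K ∧ w.Nodup ∧ (∀ s ∈ w, s ∈ R) ∧ (vl x w).Nodup ∧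
      ((vl x w).map φ).sum ≤ 3 * (K * β * ∑ y, φ y) := by
  have hK' : (0:ℝ) < K := by exact_mod_cast hK
  have hR2 : (2 * K * (K+1) : ℝ) ≤ #R := by exact_mod_cast hR
  obtain ⟨w, h1, h2, h3, h4, -, h6⟩ := block_aux R φ hφ (2 * K) (1 / K) (by positivity)
    (by nlinarith) (by
      push_cast
      have : (1 + 1/(K:ℝ)) * (#R - 2 * K) = ((K+1) * (#R - 2*K)) / K := by field_simp
      rw [this, le_div_iff₀ hK']
      nlinarith) K ∅ ∅ x (by simp)
  refine ⟨w, h1, h2, fun s hs => (h3 s hs).1, h4, h6.trans ?_⟩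
  have h7 := hh_le R φ hφ K hK β hβ x
  have h8 := hh_nonneg R φ hφ K x
  have h9 : (1 + 1/(K:ℝ))^K ≤ 3 := by
    calc (1 + 1/(K:ℝ))^K ≤ (Real.exp (1/K))^K := by
          gcongr; rw [add_comm]; exact Real.add_one_le_exp _
      _ = Real.exp 1 := by rw [← Real.exp_nat_mul]; congr 1; field_simp
      _ ≤ 3 := by have := Real.exp_one_lt_d9; linarith
  calc _ ≤ 3 * hh R φ K x := by gcongr
    _ ≤ _ := by gcongr
end block


section
variable {Γ : Type} [Group Γ] [Fintype Γ] [DecidableEq Γ]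

noncomputable def eg (T Z1 Z2 : Finset Γ) : ℝ :=
  ∑ z ∈ Z1, ∑ y ∈ Z2, if z⁻¹ * y ∈ T then (1:ℝ) else 0

noncomputable def xs (T : Finset Γ) (ω : Γ → Bool) (g : Γ) : ℝ :=
  if g ∈ T then (if ω g then 1 else -1) else 0

lemma xs_abs (T : Finset Γ) (ω : Γ → Bool) (g : Γ) : |xs T ω g| ≤ 1 := by
  unfold xs; split_ifs <;> simp

lemma xs_flip_self (T : Finset Γ) (ω : Γ → Bool) (a : Γ) :
    xs T (Function.update ω a (!ω a)) a = - xs T ω a := by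
  unfold xs; by_cases h : a ∈ T <;> cases h2 : ω a <;> simp [h, h2]

lemma xs_flip_ne (T : Finset Γ) (ω : Γ → Bool) (a b : Γ) (h : b ≠ a) :
    xs T (Function.update ω a (!ω a)) b = xs T ω b := by
  unfold xs; simp [h]

def flipE (a : Γ) : (Γ → Bool) ≃ (Γ → Bool) where
  toFun ω := Function.update ω a (!ω a)
  invFun ω := Function.update ω a (!ω a)
  left_inv ω := by simp
  right_inv ω := by simp

lemma sum_four_zero (T : Finset Γ) (a b c e : Γ) (hb : b ≠ a) (hc : c ≠ a) (he : e ≠ a) :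
    ∑ ω : Γ → Bool, xs T ω a * xs T ω b * (xs T ω c * xs T ω e) = 0 := by
  have h := Equiv.sum_comp (flipE a) (fun ω => xs T ω a * xs T ω b * (xs T ω c * xs T ω e))
  have h2 : ∀ ω, xs T (flipE a ω) a * xs T (flipE a ω) b * (xs T (flipE a ω) c * xs T (flipE a ω) e)
      = - (xs T ω a * xs T ω b * (xs T ω c * xs T ω e)) := by
    intro ω
    change xs T (Function.update ω a (!ω a)) a * xs T (Function.update ω a (!ω a)) b *
      (xs T (Function.update ω a (!ω a)) c * xs T (Function.update ω a (!ω a)) e) = _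
    rw [xs_flip_self, xs_flip_ne _ _ _ _ hb, xs_flip_ne _ _ _ _ hc, xs_flip_ne _ _ _ _ he]
    ring
  rw [Finset.sum_congr rfl (fun ω _ => h2 ω), Finset.sum_neg_distrib] at h
  linarith

lemma sum_four_le (T : Finset Γ) (a b c e : Γ) :
    ∑ ω : Γ → Bool, xs T ω a * xs T ω b * (xs T ω c * xs T ω e) ≤ Fintype.card (Γ → Bool) := by
  calc _ ≤ ∑ ω : Γ → Bool, (1:ℝ) := by
        apply Finset.sum_le_sum
        intro ω _
        refine le_trans (le_abs_self _) ?_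
        rw [abs_mul, abs_mul, abs_mul]
        have := xs_abs T ω a
        have := xs_abs T ω b
        have := xs_abs T ω c
        have := xs_abs T ω e
        have h1 : |xs T ω a| * |xs T ω b| ≤ 1 := mul_le_one₀ (by assumption) (abs_nonneg _) (by assumption)
        have h2 : |xs T ω c| * |xs T ω e| ≤ 1 := mul_le_one₀ (by assumption) (abs_nonneg _) (by assumption)
        exact mul_le_one₀ h1 (by positivity) h2
    _ = _ := by simp

noncomputable def quad (T X : Finset Γ) (ω : Γ → Bool) : ℝ :=
  ∑ y ∈ X, ∑ y' ∈ X, (∑ z ∈ X, xs T ω (z⁻¹ * y) * xs T ω (z⁻¹ * y')) ^ 2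

lemma quad_avg (T X : Finset Γ) :
    ∑ ω : Γ → Bool, quad T X ω ≤ Fintype.card (Γ → Bool) * (3 * (#X:ℝ) ^ 3) := by
  have h1 : ∀ ω, quad T X ω = ∑ y ∈ X, ∑ y' ∈ X, ∑ z ∈ X, ∑ z' ∈ X,
      xs T ω (z⁻¹ * y) * xs T ω (z⁻¹ * y') * (xs T ω (z'⁻¹ * y) * xs T ω (z'⁻¹ * y')) := by
    intro ω
    unfold quad
    refine sum_congr rfl fun y _ => sum_congr rfl fun y' _ => ?_
    rw [sq, Finset.sum_mul_sum]
  simp_rw [h1]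
  rw [Finset.sum_comm]
  simp_rw [Finset.sum_comm (s := (univ : Finset (Γ → Bool)))]
  set M : ℝ := (Fintype.card (Γ → Bool) : ℝ)
  have hM : 0 ≤ M := by positivity
  have h2 : ∀ y y' z z' : Γ, ∑ ω : Γ → Bool,
      xs T ω (z⁻¹ * y) * xs T ω (z⁻¹ * y') * (xs T ω (z'⁻¹ * y) * xs T ω (z'⁻¹ * y'))
      ≤ M * ((if y' = y then 1 else 0) + (if z' = z then 1 else 0) +
          (if z' = y' * (z⁻¹ * y)⁻¹ then 1 else 0)) := by
    intro y y' z z'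
    by_cases hy : y' = y
    · refine (sum_four_le T _ _ _ _).trans ?_
      rw [if_pos hy]; split_ifs <;> nlinarith
    by_cases hz : z' = z
    · refine (sum_four_le T _ _ _ _).trans ?_
      rw [if_pos hz]; split_ifs <;> nlinarith
    by_cases hd : z' = y' * (z⁻¹ * y)⁻¹
    · refine (sum_four_le T _ _ _ _).trans ?_
      rw [if_pos hd]; split_ifs <;> nlinarith
    · rw [sum_four_zero]
      · rw [if_neg hy, if_neg hz, if_neg hd]; simp
      · simpa using hy
      · simpa using hz
      · intro h; apply hd; rw [← h]; group
  calc _ ≤ ∑ y ∈ X, ∑ y' ∈ X, ∑ z ∈ X, ∑ z' ∈ X, M * ((if y' = y then 1 else 0) + (if z' = z then 1 else 0) +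
          (if z' = y' * (z⁻¹ * y)⁻¹ then 1 else 0)) := by
        refine sum_le_sum fun y _ => sum_le_sum fun y' _ => sum_le_sum fun z _ =>
          sum_le_sum fun z' _ => h2 y y' z z'
    _ ≤ ∑ y ∈ X, ∑ y' ∈ X, ∑ z ∈ X, M * ((#X:ℝ) * (if y' = y then 1 else 0) + 2) := by
        refine sum_le_sum fun y _ => sum_le_sum fun y' _ => sum_le_sum fun z _ => ?_
        rw [← Finset.mul_sum]
        apply mul_le_mul_of_nonneg_left _ hM
        rw [Finset.sum_add_distrib, Finset.sum_add_distrib, Finset.sum_const, nsmul_eq_mul,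
          Finset.sum_ite_eq', Finset.sum_ite_eq']
        split_ifs <;> linarith
    _ = ∑ y ∈ X, M * #X * (#X * 1 + 2 * #X) := by
        refine sum_congr rfl fun y hy => ?_
        simp_rw [Finset.sum_const, nsmul_eq_mul, mul_add, Finset.sum_add_distrib]
        simp_rw [← mul_assoc, ← Finset.mul_sum, Finset.sum_ite_eq', if_pos hy, Finset.sum_const, nsmul_eq_mul]
        ring
    _ = _ := by
        rw [Finset.sum_const, nsmul_eq_mul]; ring

lemma disc_le (T X Z1 Z2 : Finset Γ) (ω : Γ → Bool) (h1 : Z1 ⊆ X) (h2 : Z2 ⊆ X) :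
    (∑ z ∈ Z1, ∑ y ∈ Z2, xs T ω (z⁻¹ * y)) ^ 4 ≤ (#X:ℝ) ^ 4 * quad T X ω := by
  set n : ℝ := (#X : ℝ)
  have hn : 0 ≤ n := by positivity
  have hc1 : (#Z1:ℝ) ≤ n := Nat.cast_le.2 (card_le_card h1)
  have hc2 : (#Z2:ℝ) ≤ n := Nat.cast_le.2 (card_le_card h2)
  have a1 : (∑ z ∈ Z1, ∑ y ∈ Z2, xs T ω (z⁻¹ * y)) ^ 2 ≤
      n * ∑ y ∈ Z2, ∑ y' ∈ Z2, ∑ z ∈ X, xs T ω (z⁻¹ * y) * xs T ω (z⁻¹ * y') := by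
    calc _ ≤ (#Z1:ℝ) * ∑ z ∈ Z1, (∑ y ∈ Z2, xs T ω (z⁻¹ * y)) ^ 2 := sq_sum_le_card_mul_sum_sq
      _ ≤ n * ∑ z ∈ X, (∑ y ∈ Z2, xs T ω (z⁻¹ * y)) ^ 2 := by
        apply mul_le_mul hc1 _ (sum_nonneg fun _ _ => sq_nonneg _) hn
        exact sum_le_sum_of_subset_of_nonneg h1 (fun _ _ _ => sq_nonneg _)
      _ = _ := by
        congr 1
        simp_rw [sq, Finset.sum_mul_sum]
        rw [Finset.sum_comm]
        refine sum_congr rfl fun y _ => ?_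
        rw [Finset.sum_comm]
  have a2 : (∑ y ∈ Z2, ∑ y' ∈ Z2, ∑ z ∈ X, xs T ω (z⁻¹ * y) * xs T ω (z⁻¹ * y')) ^ 2
      ≤ n ^ 2 * quad T X ω := by
    rw [← Finset.sum_product' (f := fun y y' => ∑ z ∈ X, xs T ω (z⁻¹ * y) * xs T ω (z⁻¹ * y'))]
    calc _ ≤ (#(Z2 ×ˢ Z2):ℝ) * ∑ p ∈ Z2 ×ˢ Z2, (∑ z ∈ X, xs T ω (z⁻¹ * p.1) * xs T ω (z⁻¹ * p.2)) ^ 2 :=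
          sq_sum_le_card_mul_sum_sq
      _ ≤ n ^ 2 * ∑ p ∈ X ×ˢ X, (∑ z ∈ X, xs T ω (z⁻¹ * p.1) * xs T ω (z⁻¹ * p.2)) ^ 2 := by
          apply mul_le_mul _ _ (sum_nonneg fun _ _ => sq_nonneg _) (by positivity)
          · rw [card_product]; push_cast; rw [sq]; exact mul_le_mul hc2 hc2 (by positivity) hn
          · exact sum_le_sum_of_subset_of_nonneg (product_subset_product h2 h2) (fun _ _ _ => sq_nonneg _)
      _ = _ := by
          unfold quad
          rw [← Finset.sum_product' (f := fun y y' => (∑ z ∈ X, xs T ω (z⁻¹ * y) * xs T ω (z⁻¹ * y')) ^ 2)]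
  calc _ = ((∑ z ∈ Z1, ∑ y ∈ Z2, xs T ω (z⁻¹ * y)) ^ 2) ^ 2 := by ring
    _ ≤ (n * ∑ y ∈ Z2, ∑ y' ∈ Z2, ∑ z ∈ X, xs T ω (z⁻¹ * y) * xs T ω (z⁻¹ * y')) ^ 2 :=
        pow_le_pow_left₀ (sq_nonneg _) a1 2
    _ = n ^ 2 * (∑ y ∈ Z2, ∑ y' ∈ Z2, ∑ z ∈ X, xs T ω (z⁻¹ * y) * xs T ω (z⁻¹ * y')) ^ 2 := by ring
    _ ≤ n ^ 2 * (n ^ 2 * quad T X ω) := by gcongr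
    _ = _ := by ring

lemma halving (T X : Finset Γ) (κ : ℝ) (hκ : 0 < κ) (hn : 3 / κ ^ 4 ≤ (#X:ℝ)) :
    ∃ R ⊆ T, 2 * #R ≤ #T ∧ ∀ Z1 ⊆ X, ∀ Z2 ⊆ X,
      eg T Z1 Z2 - κ * (#X:ℝ) ^ 2 ≤ 2 * eg R Z1 Z2 := by
  obtain ⟨ω, -, hω⟩ : ∃ ω ∈ (univ : Finset (Γ → Bool)), quad T X ω ≤ 3 * (#X:ℝ) ^ 3 := by
    apply exists_le_of_sum_le univ_nonempty
    simpa using quad_avg T X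
  have hd : ∀ Z1 ⊆ X, ∀ Z2 ⊆ X, |∑ z ∈ Z1, ∑ y ∈ Z2, xs T ω (z⁻¹ * y)| ≤ κ * (#X:ℝ)^2 := by
    intro Z1 h1 Z2 h2
    have := disc_le T X Z1 Z2 ω h1 h2
    have h3 : (∑ z ∈ Z1, ∑ y ∈ Z2, xs T ω (z⁻¹ * y)) ^ 4 ≤ (κ * (#X:ℝ)^2) ^ 4 := by
      refine this.trans ?_
      have h4 : 3 ≤ κ ^ 4 * #X := by rwa [div_le_iff₀' (by positivity)] at hn
      calc (#X:ℝ) ^ 4 * quad T X ω ≤ (#X:ℝ) ^ 4 * (3 * (#X:ℝ) ^ 3) := by gcongr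
        _ = 3 * (#X:ℝ)^7 := by ring
        _ ≤ (κ ^ 4 * #X) * (#X:ℝ)^7 := by gcongr
        _ = _ := by ring
    have h5 := (pow_le_pow_iff_left₀ (abs_nonneg _) (by positivity) (by norm_num : (4:ℕ) ≠ 0)).1
      (show |∑ z ∈ Z1, ∑ y ∈ Z2, xs T ω (z⁻¹ * y)| ^ 4 ≤ (κ * (#X:ℝ)^2) ^ 4 by
        rwa [Even.pow_abs (by decide)])
    exact h5
  have e1 : ∀ Z1 Z2, 2 * eg (T.filter (fun g => ω g = true)) Z1 Z2
      = eg T Z1 Z2 + ∑ z ∈ Z1, ∑ y ∈ Z2, xs T ω (z⁻¹ * y) := by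
    intro Z1 Z2
    unfold eg xs
    simp_rw [Finset.mul_sum, ← Finset.sum_add_distrib]
    refine sum_congr rfl fun z _ => sum_congr rfl fun y _ => ?_
    by_cases h : z⁻¹ * y ∈ T <;> cases h2 : ω (z⁻¹ * y) <;> simp [h, h2] <;> norm_num
  have e2 : ∀ Z1 Z2, 2 * eg (T.filter (fun g => ¬ ω g = true)) Z1 Z2
      = eg T Z1 Z2 - ∑ z ∈ Z1, ∑ y ∈ Z2, xs T ω (z⁻¹ * y) := by
    intro Z1 Z2
    unfold eg xs
    simp_rw [Finset.mul_sum, ← Finset.sum_sub_distrib]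
    refine sum_congr rfl fun z _ => sum_congr rfl fun y _ => ?_
    by_cases h : z⁻¹ * y ∈ T <;> cases h2 : ω (z⁻¹ * y) <;> simp [h, h2] <;> norm_num
  have hcard := card_filter_add_card_filter_not (s := T) (fun g => ω g = true)
  by_cases hh : 2 * #(T.filter (fun g => ω g = true)) ≤ #T
  · refine ⟨_, filter_subset _ _, hh, fun Z1 h1 Z2 h2 => ?_⟩
    rw [e1]; have := abs_le.1 (hd Z1 h1 Z2 h2); linarith
  · refine ⟨T.filter (fun g => ¬ ω g = true), filter_subset _ _, by omega, fun Z1 h1 Z2 h2 => ?_⟩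
    rw [e2]; have := abs_le.1 (hd Z1 h1 Z2 h2); linarith

/-- iterated halving -/
lemma halving_iter (r : ℕ) (κ : ℝ) (hκ : 0 < κ) : ∀ (T X : Finset Γ), 
    3 / (κ / 2) ^ 4 ≤ (#X:ℝ) →
    ∃ R ⊆ T, 2 ^ r * #R ≤ #T ∧ ∀ Z1 ⊆ X, ∀ Z2 ⊆ X,
      eg T Z1 Z2 - 2 ^ r * κ * (#X:ℝ) ^ 2 ≤ 2 ^ r * eg R Z1 Z2 := by
  induction r with
  | zero =>
    intro T X hn
    refine ⟨T, Subset.refl _, by simp, fun Z1 _ Z2 _ => ?_⟩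
    have : 0 ≤ κ * (#X:ℝ)^2 := by positivity
    simp; linarith
  | succ r ih =>
    intro T X hn
    obtain ⟨R, hR, hc, hd⟩ := ih T X hn
    obtain ⟨R', hR', hc', hd'⟩ := halving R X (κ / 2) (by positivity) hn
    refine ⟨R', hR'.trans hR, ?_, fun Z1 h1 Z2 h2 => ?_⟩
    · calc 2 ^ (r+1) * #R' = 2 ^ r * (2 * #R') := by ring
        _ ≤ 2 ^ r * #R := by gcongr
        _ ≤ _ := hc
    · have a := hd Z1 h1 Z2 h2
      have b := hd' Z1 h1 Z2 h2
      have p : (0:ℝ) < 2 ^ r := by positivity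
      have := mul_le_mul_of_nonneg_left b p.le
      rw [pow_succ]
      have q : 0 ≤ 2 ^ r * κ * (#X:ℝ)^2 := by positivity
      nlinarith
end


section
variable {Γ : Type} [Group Γ] [Fintype Γ] [DecidableEq Γ]

/-- in-edges of a path -/
def ie (p : Γ × List Γ) : Multiset (Γ × Γ) := ((vl p.1 p.2).zip p.2 : List (Γ × Γ))

lemma ie_append (x : Γ) (a b : List Γ) : ie (x, a ++ b) = ie (x, a) + ie (x * a.prod, b) := by
  unfold ie
  simp only [vl_append]
  rw [List.zip_append (vl_length x a)]
  simp

lemma ie_cons (x s : Γ) (b : List Γ) : ie (x, s :: b) = (x * s, s) ::ₘ ie (x * s, b) := by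
  unfold ie; simp

lemma ie_nil (x : Γ) : ie (x, []) = 0 := by simp [ie]

lemma ie_fst (p : Γ × List Γ) : (ie p).map Prod.fst = (vl p.1 p.2 : Multiset Γ) := by
  unfold ie
  rw [Multiset.map_coe, List.map_fst_zip (by rw [vl_length])]

lemma ie_snd (p : Γ × List Γ) : (ie p).map Prod.snd = (p.2 : Multiset Γ) := by
  unfold ie
  rw [Multiset.map_coe, List.map_snd_zip (by rw [vl_length])]

abbrev Fst (Γ : Type) := Multiset (Γ × List Γ)

def fE (F : Fst Γ) : Multiset (Γ × Γ) := F.bind ie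
def fV (F : Fst Γ) : Multiset Γ := F.map Prod.fst + (fE F).map Prod.fst
def fC (F : Fst Γ) : Multiset Γ := (fE F).map Prod.snd

@[simp] lemma fE_cons (p) (F : Fst Γ) : fE (p ::ₘ F) = ie p + fE F := by simp [fE]
@[simp] lemma fE_add (F G : Fst Γ) : fE (F + G) = fE F + fE G := by simp [fE]
@[simp] lemma fV_cons (p) (F : Fst Γ) : fV (p ::ₘ F) = p.1 ::ₘ (vl p.1 p.2 : Multiset Γ) + fV F := by
  simp only [fV, Multiset.map_cons, fE_cons, Multiset.map_add, ie_fst]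
  simp only [Multiset.cons_add, add_assoc]
  rw [add_left_comm]
@[simp] lemma fV_add (F G : Fst Γ) : fV (F + G) = fV F + fV G := by
  simp only [fV, Multiset.map_add, fE_add]; abel
@[simp] lemma fC_cons (p) (F : Fst Γ) : fC (p ::ₘ F) = (p.2 : Multiset Γ) + fC F := by
  simp only [fC, fE_cons, Multiset.map_add, ie_snd]
@[simp] lemma fC_add (F G : Fst Γ) : fC (F + G) = fC F + fC G := by
  simp only [fC, Multiset.map_add, fE_add]

lemma mem_fV {F : Fst Γ} {v : Γ} : v ∈ fV F ↔ ∃ p ∈ F, v = p.1 ∨ v ∈ vl p.1 p.2 := by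
  induction F using Multiset.induction_on with
  | empty => simp [fV, fE]
  | cons p F ih => simp [ih, or_assoc]

structure Good (X T : Finset Γ) (N : ℕ) (F : Fst Γ) : Prop where
  vn : (fV F).Nodup
  vx : ∀ v ∈ fV F, v ∈ X
  cn : (fC F).Nodup
  ct : ∀ c ∈ fC F, c ∈ T
  card : F.card = N

lemma fV_card (F : Fst Γ) : (fV F).card = F.card + (fC F).card := by simp [fV, fC]

/-- adding an edge `(b,s)` to the forest -/
lemma good_grow {X T : Finset Γ} {N : ℕ} {F F' : Fst Γ} (h : Good X T N F) {s b : Γ}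
    (hs : s ∉ fC F) (hsT : s ∈ T) (hb : b ∉ fV F) (hbX : b ∈ X) (hst : F'.map Prod.fst = F.map Prod.fst)
    (hE : fE F' = (b, s) ::ₘ fE F) : Good X T N F' ∧ (fC F').card = (fC F).card + 1 := by
  have hV : fV F' = b ::ₘ fV F := by simp [fV, hst, hE]
  have hC : fC F' = s ::ₘ fC F := by simp [fC, hE]
  refine ⟨⟨?_, ?_, ?_, ?_, ?_⟩, by simp [hC]⟩
  · rw [hV]; exact Multiset.nodup_cons.2 ⟨hb, h.vn⟩
  · rw [hV]; intro v hv; rcases Multiset.mem_cons.1 hv with rfl | hv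
    · exact hbX
    · exact h.vx v hv
  · rw [hC]; exact Multiset.nodup_cons.2 ⟨hs, h.cn⟩
  · rw [hC]; intro v hv; rcases Multiset.mem_cons.1 hv with rfl | hv
    · exact hsT
    · exact h.ct v hv
  · rw [← h.card, ← Multiset.card_map Prod.fst F', hst, Multiset.card_map]

/-- The switch. -/
lemma switch {X T : Finset Γ} {N m : ℕ} {p : Γ × List Γ} {L H : Fst Γ} {s b : Γ}
    (hg : Good X T N (p ::ₘ (L + H))) (hm : (fC (p ::ₘ (L + H))).card = m)
    (hmax : ∀ F, Good X T N F → (fC F).card ≤ m) (hTX : #T + N < #X)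
    (hs : s ∉ fC (p ::ₘ (L + H))) (hsT : s ∈ T) (hb : b = p.1 * p.2.prod * s) (hbX : b ∈ X)
    (hbp : b ∉ fV (p ::ₘ L)) :
    ∃ c A H2, fE (p ::ₘ (L + H)) = (b, c) ::ₘ A ∧ Good X T N (L + H2) ∧ (fC (L + H2)).card = m ∧
      fV (L + H2) = fV (p ::ₘ (L + H)) ∧ fE (L + H2) = (b, s) ::ₘ A := by
  obtain ⟨x, w⟩ := p
  have hT : m + N < #X := by
    have : (fC ((x,w) ::ₘ (L + H))).card ≤ #T := by
      have h0 : fC ((x,w) ::ₘ (L + H)) ≤ T.val := (Multiset.le_iff_subset hg.cn).2 (fun c hc => hg.ct c hc)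
      exact Multiset.card_le_card h0
    omega
  by_cases h1 : b ∈ fV ((x,w) ::ₘ (L + H))
  swap
  · exfalso
    have := good_grow (F' := (x, w ++ [s]) ::ₘ (L + H)) hg hs hsT h1 hbX (by simp) (by
      simp only [fE_cons, ie_append, ie_cons, ie_nil]
      rw [hb]; simp only [add_assoc, Multiset.cons_add, zero_add, Multiset.add_cons])
    have := hmax _ this.1
    omega
  have h2 : b ∈ fV H := by
    simp only [fV_cons, fV_add, Multiset.mem_add] at h1 hbp
    tauto
  obtain ⟨⟨y, u⟩, hq, hbq⟩ := mem_fV.1 h2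
  obtain ⟨H', rfl⟩ := Multiset.exists_cons_of_mem hq
  rcases hbq with hby | hbu
  · exfalso
    simp only at hby
    subst hby
    obtain ⟨z, hz⟩ : ∃ z ∈ X, z ∉ fV ((x,w) ::ₘ (L + (b,u) ::ₘ H')) := by
      by_contra hcon
      push Not at hcon
      have h3 : X.val ≤ fV ((x,w) ::ₘ (L + (b,u) ::ₘ H')) := (Multiset.le_iff_subset X.nodup).2 hcon
      have := Multiset.card_le_card h3
      rw [fV_card, hg.card, hm] at this
      simp at this
      omega
    have hE : fE ((z, []) ::ₘ (x, w ++ s :: u) ::ₘ (L + H')) = (b, s) ::ₘ fE ((x,w) ::ₘ (L + (b,u) ::ₘ H')) := by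
      simp only [fE_cons, fE_add, ie_append, ie_cons, ie_nil, ← hb]
      rw [← Multiset.singleton_add, ← Multiset.singleton_add]; abel
    have hV : fV ((z, []) ::ₘ (x, w ++ s :: u) ::ₘ (L + H')) = z ::ₘ fV ((x,w) ::ₘ (L + (b,u) ::ₘ H')) := by
      rw [fV, fV, hE]
      simp only [Multiset.map_add, Multiset.map_cons]
      simp only [← Multiset.singleton_add]; abel
    have hC : fC ((z, []) ::ₘ (x, w ++ s :: u) ::ₘ (L + H')) = s ::ₘ fC ((x,w) ::ₘ (L + (b,u) ::ₘ H')) := by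
      simp only [fC, hE, Multiset.map_cons]
    have hg' : Good X T N ((z, []) ::ₘ (x, w ++ s :: u) ::ₘ (L + H')) := by
      refine ⟨?_, ?_, ?_, ?_, ?_⟩
      · rw [hV]; exact Multiset.nodup_cons.2 ⟨hz.2, hg.vn⟩
      · rw [hV]; intro v hv; rcases Multiset.mem_cons.1 hv with rfl | hv
        · exact hz.1
        · exact hg.vx v hv
      · rw [hC]; exact Multiset.nodup_cons.2 ⟨hs, hg.cn⟩
      · rw [hC]; intro v hv; rcases Multiset.mem_cons.1 hv with rfl | hv
        · exact hsT
        · exact hg.ct v hv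
      · rw [← hg.card]; simp
    have := hmax _ hg'
    rw [hC, Multiset.card_cons] at this
    omega
  · simp only at hbu
    obtain ⟨c, u1, u2, rfl, hbc⟩ : ∃ c u1 u2, u = u1 ++ c :: u2 ∧ b = y * u1.prod * c := by
      clear hq h2 h1 hs hm hg
      induction u generalizing y with
      | nil => simp at hbu
      | cons c u ih =>
        rw [vl_cons, List.mem_cons] at hbu
        rcases hbu with h | h
        · exact ⟨c, [], u, by simp, by simpa using h⟩
        · obtain ⟨c', u1, u2, h1, h2⟩ := ih _ h
          exact ⟨c', c :: u1, u2, by simp [h1], by simp [h2, mul_assoc]⟩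
    have e1 : fE ((x,w) ::ₘ (L + (y, u1 ++ c :: u2) ::ₘ H')) = 
        (b, c) ::ₘ (ie (x,w) + ie (y,u1) + ie (b, u2) + fE L + fE H') := by
      simp only [fE_cons, fE_add, ie_append, ie_cons, ← hbc]
      rw [← Multiset.singleton_add, ← Multiset.singleton_add]; abel
    have e2 : fE (L + ((x, w ++ s :: u2) ::ₘ (y, u1) ::ₘ H')) = 
        (b, s) ::ₘ (ie (x,w) + ie (y,u1) + ie (b, u2) + fE L + fE H') := by
      simp only [fE_cons, fE_add, ie_append, ie_cons, ← hb]
      rw [← Multiset.singleton_add, ← Multiset.singleton_add]; abel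
    have e3 : fV (L + ((x, w ++ s :: u2) ::ₘ (y, u1) ::ₘ H')) = fV ((x,w) ::ₘ (L + (y, u1 ++ c :: u2) ::ₘ H')) := by
      rw [fV, fV, e1, e2]
      simp only [Multiset.map_add, Multiset.map_cons]
      simp only [← Multiset.singleton_add]; abel
    have c1 : fC ((x,w) ::ₘ (L + (y, u1 ++ c :: u2) ::ₘ H')) = 
        c ::ₘ ((ie (x,w) + ie (y,u1) + ie (b, u2) + fE L + fE H').map Prod.snd) := by
      rw [fC, e1, Multiset.map_cons]
    have c2 : fC (L + ((x, w ++ s :: u2) ::ₘ (y, u1) ::ₘ H')) = 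
        s ::ₘ ((ie (x,w) + ie (y,u1) + ie (b, u2) + fE L + fE H').map Prod.snd) := by
      rw [fC, e2, Multiset.map_cons]
    refine ⟨c, _, _, e1, ⟨?_, ?_, ?_, ?_, ?_⟩, ?_, e3, e2⟩
    · rw [e3]; exact hg.vn
    · rw [e3]; exact hg.vx
    · rw [c2]
      have := hg.cn
      rw [c1] at this
      rw [c1] at hs
      refine Multiset.nodup_cons.2 ⟨fun h => hs (Multiset.mem_cons_of_mem h), (Multiset.nodup_cons.1 this).2⟩
    · rw [c2]; intro v hv; rcases Multiset.mem_cons.1 hv with rfl | hv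
      · exact hsT
      · apply hg.ct v; rw [c1]; exact Multiset.mem_cons_of_mem hv
    · rw [← hg.card]; simp
    · rw [← hm, c1, c2]; simp

/-- iteration of switches along designated paths -/
lemma switch_iter {X T D : Finset Γ} {N m a : ℕ} {F : Fst Γ} (hF : Good X T N F)
    (hFm : (fC F).card = m)
    (hmax : ∀ F, Good X T N F → (fC F).card ≤ m) (hTX : #T + N < #X) (L : List (Γ × List Γ)) :
    ∀ U : Finset Γ, U ⊆ T → T \ (fC F).toFinset ⊆ U →
    (∀ p ∈ L, #{s ∈ T | p.1 * p.2.prod * s ∉ X} ≤ a) → (∀ v ∈ fV (L : Fst Γ), v ∈ D) →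
    (∀ s ∈ U, ∃ H, Good X T N ((L : Fst Γ) + H) ∧ (fC ((L : Fst Γ) + H)).card = m ∧ s ∉ fC ((L : Fst Γ) + H) ∧ 
      fV ((L : Fst Γ) + H) = fV F ∧
      ∀ b c, (b, c) ∈ fE ((L : Fst Γ) + H) → (b, c) ∈ fE F ∨ ∃ c' ∈ U, (b, c') ∈ fE F) →
    #U + L.length * (#T) ≤ #T + L.length * (m + a + #D) := by
  induction L with
  | nil => intro U hU _ _ _ _; simpa using card_le_card hU
  | cons p L ih =>
    intro U hUT hU0 htyp hD hU
    classical
    -- in-colours of reached vertices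
    set B : Finset Γ := (U.image (fun s => p.1 * p.2.prod * s)).filter (fun b => b ∈ X ∧ b ∉ D) with hB
    have hBcard : #U ≤ #B + a + #D := by
      have h1 : #(U.image (fun s => p.1 * p.2.prod * s)) = #U :=
        card_image_of_injective _ (mul_right_injective _)
      have h2 : U.image (fun s => p.1 * p.2.prod * s) ⊆
          B ∪ ((T.filter (fun s => p.1 * p.2.prod * s ∉ X)).image (fun s => p.1 * p.2.prod * s) ∪ D) := by
        intro b hb
        obtain ⟨s, hs, rfl⟩ := mem_image.1 hb
        by_cases h3 : p.1 * p.2.prod * s ∈ X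
        · by_cases h4 : p.1 * p.2.prod * s ∈ D
          · simp [h4]
          · apply mem_union_left; rw [hB, mem_filter]; exact ⟨hb, h3, h4⟩
        · apply mem_union_right; apply mem_union_left
          exact mem_image_of_mem _ (mem_filter.2 ⟨hUT hs, h3⟩)
      have h3 := card_le_card h2
      have h4 := card_union_le B ((T.filter (fun s => p.1 * p.2.prod * s ∉ X)).image (fun s => p.1 * p.2.prod * s) ∪ D)
      have h5 := card_union_le ((T.filter (fun s => p.1 * p.2.prod * s ∉ X)).image (fun s => p.1 * p.2.prod * s)) D
      have h6 := card_image_le (s := T.filter (fun s => p.1 * p.2.prod * s ∉ X)) (f := fun s => p.1 * p.2.prod * s)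
      have h7 := htyp p (by simp)
      omega
    have key : ∀ b ∈ B, ∃ c, (b, c) ∈ fE F ∧ (c ∈ U ∨ ∃ s ∈ U, ∃ H A H2, 
        fE (p ::ₘ ((L : Fst Γ) + H)) = (b, c) ::ₘ A ∧ Good X T N ((L : Fst Γ) + H2) ∧ (fC ((L : Fst Γ) + H2)).card = m ∧
        fV ((L : Fst Γ) + H2) = fV F ∧ c ∉ fC ((L : Fst Γ) + H2) ∧
        fE ((L : Fst Γ) + H2) = (b, s) ::ₘ A ∧
        ∀ b c, (b, c) ∈ fE (p ::ₘ ((L : Fst Γ) + H)) → (b, c) ∈ fE F ∨ ∃ c' ∈ U, (b, c') ∈ fE F) := by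
      intro b hb
      rw [hB, mem_filter] at hb
      obtain ⟨hb1, hbX, hbD⟩ := hb
      obtain ⟨s, hs, hsb⟩ := mem_image.1 hb1
      obtain ⟨H, hg, hm, hsc, hV, hinv⟩ := hU s hs
      have hcons : ((p :: L : List (Γ × List Γ)) : Fst Γ) + H = p ::ₘ ((L : Fst Γ) + H) := by
        rw [← Multiset.cons_coe, Multiset.cons_add]
      rw [hcons] at hg hm hsc hV hinv
      obtain ⟨c, A, H2, h1, h2, h3, h4, h5⟩ := switch (b := b) hg hm hmax hTX hsc (hUT hs) hsb.symm hbX (by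
        intro h; apply hbD; apply hD; rwa [← Multiset.cons_coe])
      rcases hinv b c (by rw [h1]; simp) with h6 | ⟨c', hc', h6⟩
      · refine ⟨c, h6, Or.inr ⟨s, hs, H, A, H2, h1, h2, h3, h4.trans hV, ?_, h5, hinv⟩⟩
        intro hc
        rw [fC, h5, Multiset.map_cons, Multiset.mem_cons] at hc
        have hn := hg.cn
        rw [fC, h1, Multiset.map_cons, Multiset.nodup_cons] at hn
        rcases hc with hc | hc
        · simp only at hc
          apply hsc; rw [fC, h1, ← hc]; simp
        · exact hn.1 hc
      · exact ⟨c', h6, Or.inl hc'⟩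
    choose! f hf1 hf2 using key
    have hinj : Set.InjOn f B := by
      intro b hb b' hb' h
      have h1 := hf1 b hb
      have h2 := hf1 b' hb'
      rw [h] at h1
      have hn := hF.cn
      have := Multiset.inj_on_of_nodup_map hn _ h1 _ h2 rfl
      simpa using congrArg Prod.fst this
    have hfC : ∀ b ∈ B, f b ∈ fC F := by
      intro b hb; rw [fC, Multiset.mem_map]; exact ⟨_, hf1 b hb, rfl⟩
    have hmT : #T = m + #(T \ (fC F).toFinset) := by
      rw [card_sdiff_of_subset (fun c hc => hF.ct c (Multiset.mem_toFinset.1 hc)),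
        Multiset.toFinset_card_of_nodup hF.cn, hFm]
      have : m ≤ #T := by
        rw [← hFm, ← Multiset.toFinset_card_of_nodup hF.cn]
        exact card_le_card (fun c hc => hF.ct c (Multiset.mem_toFinset.1 hc))
      omega
    have hstep := ih (U ∪ B.image f) ?_ ?_ ?_ ?_ ?_
    · have h1 : #(T \ (fC F).toFinset) + #B ≤ #(U ∪ B.image f) := by
        rw [← card_image_of_injOn hinj, ← card_union_of_disjoint]
        · apply card_le_card; exact union_subset_union hU0 (Subset.refl _)
        · rw [Finset.disjoint_left]
          intro c hc hc'
          obtain ⟨b, hb, rfl⟩ := mem_image.1 hc'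
          exact (mem_sdiff.1 hc).2 (Multiset.mem_toFinset.2 (hfC b hb))
      simp only [List.length_cons]
      have : (L.length + 1) * #T = L.length * #T + #T := by ring
      have : (L.length + 1) * (m + a + #D) = L.length * (m + a + #D) + (m + a + #D) := by ring
      omega
    · apply union_subset hUT
      intro c hc
      obtain ⟨b, hb, rfl⟩ := mem_image.1 hc
      exact hF.ct _ (hfC b hb)
    · exact hU0.trans subset_union_left
    · intro q hq; exact htyp q (by simp [hq])
    · intro v hv; apply hD; rw [← Multiset.cons_coe, fV_cons]; simp [hv]
    · have keyU : ∀ s ∈ U, ∃ H, Good X T N ((L : Fst Γ) + H) ∧ (fC ((L : Fst Γ) + H)).card = m ∧ s ∉ fC ((L : Fst Γ) + H) ∧ 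
          fV ((L : Fst Γ) + H) = fV F ∧
          ∀ b c, (b, c) ∈ fE ((L : Fst Γ) + H) → (b, c) ∈ fE F ∨ ∃ c' ∈ U ∪ B.image f, (b, c') ∈ fE F := by
        intro s hs
        obtain ⟨H, hg, hm, hsc, hV, hinv⟩ := hU s hs
        have hcons : ((p :: L : List (Γ × List Γ)) : Fst Γ) + H = (L : Fst Γ) + (p ::ₘ H) := by
          rw [← Multiset.cons_coe, Multiset.cons_add, Multiset.add_cons]
        rw [hcons] at hg hm hsc hV hinv
        refine ⟨p ::ₘ H, hg, hm, hsc, hV, fun b c hbc => ?_⟩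
        rcases hinv b c hbc with h | ⟨c', h1, h2⟩
        · exact Or.inl h
        · exact Or.inr ⟨c', mem_union_left _ h1, h2⟩
      intro c hc
      rcases mem_union.1 hc with hc | hc
      · exact keyU c hc
      obtain ⟨b, hb, rfl⟩ := mem_image.1 hc
      rcases hf2 b hb with h | ⟨s, hs, H, A, H2, h1, h2, h3, h4, h5, h6, h7⟩
      · exact keyU _ h
      · refine ⟨H2, h2, h3, h5, h4, fun b' c' hbc => ?_⟩
        rw [h6, Multiset.mem_cons] at hbc
        rcases hbc with hbc | hbc
        · right
          refine ⟨f b, mem_union_right _ (mem_image_of_mem _ hb), ?_⟩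
          have : b' = b := congrArg Prod.fst hbc
          rw [this]; exact hf1 b hb
        · rcases h7 b' c' (by rw [h1]; exact Multiset.mem_cons_of_mem hbc) with h | ⟨c', h8, h9⟩
          · exact Or.inl h
          · exact Or.inr ⟨c', mem_union_left _ h8, h9⟩

end


section
variable {Γ : Type} [Group Γ] [Fintype Γ] [DecidableEq Γ]

lemma end_mem (x : Γ) (w : List Γ) : x * w.prod ∈ x :: vl x w := by
  induction w generalizing x with
  | nil => simp
  | cons s w ih =>
    have := ih (x * s)
    simp only [List.prod_cons, vl_cons, ← mul_assoc] at this ⊢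
    exact List.mem_cons_of_mem _ this

lemma ends_le (F : Fst Γ) : F.map (fun p => p.1 * p.2.prod) ≤ fV F := by
  induction F using Multiset.induction_on with
  | empty => simp
  | cons p F ih =>
    rw [Multiset.map_cons, fV_cons, ← Multiset.singleton_add]
    refine add_le_add ?_ ih
    rw [Multiset.singleton_le]
    exact end_mem p.1 p.2

lemma bad_ends {X T : Finset Γ} {N : ℕ} {F : Fst Γ} (h : Good X T N F) (P : Γ → Prop) [DecidablePred P] :
    (F.filter (fun p => P (p.1 * p.2.prod))).card ≤ #{x ∈ X | P x} := by
  have h1 : (F.filter (fun p => P (p.1 * p.2.prod))).map (fun p => p.1 * p.2.prod) ≤ (X.filter P).val := by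
    rw [Multiset.le_iff_subset]
    · intro y hy
      obtain ⟨p, hp, rfl⟩ := Multiset.mem_map.1 hy
      rw [Multiset.mem_filter] at hp
      refine mem_filter.2 ⟨h.vx _ ?_, hp.2⟩
      exact Multiset.mem_of_le (ends_le F) (Multiset.mem_map_of_mem _ hp.1)
    · refine Multiset.nodup_of_le ?_ h.vn
      refine le_trans ?_ (ends_le F)
      exact Multiset.map_le_map (Multiset.filter_le _ _)
  have h2 := Multiset.card_le_card h1
  rw [Multiset.card_map] at h2
  exact h2

lemma bad_len (F : Fst Γ) (l : ℕ) : l * (F.filter (fun p => l ≤ p.2.length)).card ≤ (fC F).card := by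
  induction F using Multiset.induction_on with
  | empty => simp
  | cons p F ih =>
    rw [fC_cons, Multiset.card_add, Multiset.filter_cons]
    split_ifs with h
    · simp; rw [mul_add]; linarith
    · simp; linarith

lemma fV_short (l : ℕ) (L : List (Γ × List Γ)) (h : ∀ p ∈ L, p.2.length < l) :
    (fV (L : Fst Γ)).card ≤ L.length * l := by
  induction L with
  | nil => simp [fV, fE]
  | cons p L ih =>
    rw [← Multiset.cons_coe, fV_cons]
    have h1 := ih (fun q hq => h q (by simp [hq]))
    have h2 := h p (by simp)
    simp [vl_length]
    rw [add_mul]; linarith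

lemma forest {X T : Finset Γ} (N J a l : ℕ) (hTX : #T + N < #X)
    (hat : 4 * #{x ∈ X | a < #{s ∈ T | x * s ∉ X}} ≤ N) (hl : 4 * #X ≤ l * N) (hJ : 2 * J ≤ N) :
    ∃ F : Fst Γ, Good X T N F ∧ J * #T ≤ (J + 1) * (fC F).card + J * (a + J * l) := by
  classical
  -- maximal forest
  let Q : ℕ → Prop := fun m => ∃ F : Fst Γ, Good X T N F ∧ (fC F).card = m
  have hbound : ∀ F : Fst Γ, Good X T N F → (fC F).card ≤ #T := by
    intro F hF
    have h0 : fC F ≤ T.val := (Multiset.le_iff_subset hF.cn).2 (fun c hc => hF.ct c hc)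
    exact Multiset.card_le_card h0
  have hQ0 : Q 0 := by
    obtain ⟨Y, hY, hYc⟩ := exists_subset_card_eq (show N ≤ #X by omega)
    have e : fE (Y.val.map (fun x => (x, ([] : List Γ)))) = 0 := by
      unfold fE
      rw [Multiset.bind_map]
      simp [ie_nil]
    have v : fV (Y.val.map (fun x => (x, ([] : List Γ)))) = Y.val := by
      unfold fV
      rw [e]; simp
    have c : fC (Y.val.map (fun x => (x, ([] : List Γ)))) = 0 := by
      unfold fC; rw [e]; simp
    refine ⟨Y.val.map (fun x => (x, ([] : List Γ))), ⟨?_, ?_, ?_, ?_, ?_⟩, ?_⟩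
    · rw [v]; exact Y.nodup
    · rw [v]; exact fun x hx => hY hx
    · rw [c]; simp
    · rw [c]; simp
    · simpa using hYc
    · rw [c]; simp
  obtain ⟨F, hF, hFm⟩ : Q (Nat.findGreatest Q #T) := Nat.findGreatest_spec (Nat.zero_le _) hQ0
  have hmax : ∀ F', Good X T N F' → (fC F').card ≤ (fC F).card := by
    intro F' hF'
    rw [hFm]
    exact Nat.le_findGreatest (hbound F' hF') ⟨F', hF', rfl⟩
  refine ⟨F, hF, ?_⟩
  set P1 : Γ × List Γ → Prop := fun p => l ≤ p.2.length
  set P2 : Γ × List Γ → Prop := fun p => a < #{s ∈ T | p.1 * p.2.prod * s ∉ X}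
  have hb1 : 4 * (F.filter P1).card ≤ N := by
    have h1 : l * (F.filter P1).card ≤ _ := bad_len F l
    have h2 : (fV F).card ≤ #X := by
      have h0 : fV F ≤ X.val := (Multiset.le_iff_subset hF.vn).2 (fun c hc => hF.vx c hc)
      exact Multiset.card_le_card h0
    rw [fV_card] at h2
    have h3 : 0 < l := by
      rcases Nat.eq_zero_or_pos l with h | h
      · subst h; omega
      · exact h
    have h4 : l * (4 * (F.filter P1).card) ≤ l * N := by
      calc _ = 4 * (l * (F.filter P1).card) := by ring
        _ ≤ 4 * #X := by omega
        _ ≤ _ := hl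
    exact Nat.le_of_mul_le_mul_left h4 h3
  have hb2 : 4 * (F.filter P2).card ≤ N := by
    have : (F.filter P2).card ≤ _ := bad_ends hF (fun x => a < #{s ∈ T | x * s ∉ X})
    omega
  have hgood : J ≤ (F.filter (fun p => ¬ P1 p ∧ ¬ P2 p)).card := by
    have h1 : F.card ≤ (F.filter (fun p => ¬ P1 p ∧ ¬ P2 p)).card + (F.filter P1).card + (F.filter P2).card := by
      have : F ≤ F.filter (fun p => ¬ P1 p ∧ ¬ P2 p) + F.filter P1 + F.filter P2 := by
        rw [Multiset.le_iff_count]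
        intro p
        simp only [Multiset.count_add, Multiset.count_filter]
        split_ifs <;> first | omega | tauto
      simpa using Multiset.card_le_card this
    rw [hF.card] at h1
    omega
  set L := ((F.filter (fun p => ¬ P1 p ∧ ¬ P2 p)).toList.take J) with hL
  have hLl : L.length = J := by
    rw [hL, List.length_take, Multiset.length_toList]; omega
  have hLP : ∀ p ∈ L, ¬ P1 p ∧ ¬ P2 p := by
    intro p hp
    have := List.mem_of_mem_take hp
    rw [Multiset.mem_toList, Multiset.mem_filter] at this
    exact this.2
  have hLP1 : ∀ p ∈ L, p.2.length < l := fun p hp => not_le.1 (hLP p hp).1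
  have hLP2 : ∀ p ∈ L, #{s ∈ T | p.1 * p.2.prod * s ∉ X} ≤ a := fun p hp => not_lt.1 (hLP p hp).2
  have hLF : (L : Fst Γ) ≤ F := by
    refine le_trans ?_ (Multiset.filter_le (fun p => ¬ P1 p ∧ ¬ P2 p) F)
    conv_rhs => rw [← Multiset.coe_toList (F.filter (fun p => ¬ P1 p ∧ ¬ P2 p))]
    exact Multiset.coe_le.2 (List.take_sublist _ _).subperm
  obtain ⟨H, hH⟩ := Multiset.le_iff_exists_add.1 hLF
  clear_value L
  clear hLF hLP hL hgood hb1 hb2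
  subst hH
  have main := switch_iter (D := (fV (L : Fst Γ)).toFinset) (a := a) hF rfl hmax hTX L
    (T \ (fC ((L : Fst Γ) + H)).toFinset) sdiff_subset (Subset.refl _)
    hLP2 (fun v hv => Multiset.mem_toFinset.2 hv) (by
      intro s hs
      refine ⟨H, hF, rfl, ?_, rfl, fun b c h => Or.inl h⟩
      intro h; exact (mem_sdiff.1 hs).2 (Multiset.mem_toFinset.2 h))
  have hD : #(fV (L : Fst Γ)).toFinset ≤ J * l := by
    refine (Multiset.toFinset_card_le _).trans ?_
    rw [← hLl]
    exact fV_short l L hLP1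
  rw [card_sdiff_of_subset (fun c hc => hF.ct c (Multiset.mem_toFinset.1 hc)),
    Multiset.toFinset_card_of_nodup hF.cn, hLl] at main
  have hb := hbound _ hF
  set m := (fC ((L : Fst Γ) + H)).card
  have h5 : J * (m + a + #(fV (L : Fst Γ)).toFinset) ≤ J * (m + a + J * l) := by gcongr
  have h6 : (J + 1) * m + J * (a + J * l) = m + J * (m + a + J * l) := by ring
  omega
end


section
variable {Γ : Type} [Group Γ] [Fintype Γ] [DecidableEq Γ]

def Conn (R Q : Finset Γ) (K : ℕ) (x y : Γ) : Prop :=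
  ∃ c : List Γ, c.Nodup ∧ (∀ s ∈ c, s ∈ R ∧ s ∉ Q) ∧ c.length ≤ K ∧ x * c.prod = y

lemma Conn.mono {R Q Q' : Finset Γ} {K : ℕ} {x y : Γ} (h : Conn R Q' K x y) (hQ : Q ⊆ Q') :
    Conn R Q K x y := by
  obtain ⟨c, h1, h2, h3⟩ := h
  exact ⟨c, h1, fun s hs => ⟨(h2 s hs).1, fun h => (h2 s hs).2 (hQ h)⟩, h3⟩

def CP (X R : Finset Γ) (a K q : ℕ) : Prop :=
  ∀ E ⊆ X, ∀ Y ⊆ X, a ≤ #E → a ≤ #Y → ∀ Q : Finset Γ, #Q ≤ q → ∃ x ∈ E, ∃ y ∈ Y, Conn R Q K x y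

lemma connect {X R : Finset Γ} {a K q : ℕ} {β : ℝ} (hβ : 0 < β) (hβ1 : β < 1)
    (hK : (#X:ℝ) ^ 2 < (1 + β) ^ K * (a:ℝ) ^ 2)
    (hexp : ∀ Z ⊆ X, a ≤ #Z → a ≤ #(X \ Z) → ∀ Q : Finset Γ, #Q ≤ q + K →
      ∃ s ∈ R, s ∉ Q ∧ β * min (#Z:ℝ) (#(X \ Z):ℝ) ≤ #{z ∈ Z | z * s ∈ X \ Z}) :
    CP X R a K q := by
  intro E hE Y hY haE haY Q hQ
  by_contra hcon
  push Not at hcon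
  have key : ∀ j ≤ K, ∃ Z ⊆ X, ∃ C : List Γ, C.length = j ∧ C.Nodup ∧ (∀ s ∈ C, s ∈ R ∧ s ∉ Q) ∧
      (∀ z ∈ Z, ∃ x ∈ E, ∃ c, List.Sublist c C ∧ x * c.prod = z) ∧ a ≤ #Z ∧
      (1 + β) ^ j * a * (#(X \ Z):ℝ) ≤ #X * #Z := by
    intro j
    induction j with
    | zero =>
      intro _
      refine ⟨E, hE, [], rfl, by simp, by simp, ?_, haE, ?_⟩
      · intro z hz; exact ⟨z, hz, [], by simp, by simp⟩
      · have h1 : (#(X \ E):ℝ) ≤ #X := Nat.cast_le.2 (card_le_card sdiff_subset)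
        have h2 : (a:ℝ) ≤ #E := Nat.cast_le.2 haE
        rw [pow_zero, one_mul, mul_comm]
        exact mul_le_mul h1 h2 (by positivity) (by positivity)
    | succ j ih =>
      intro hj
      obtain ⟨Z, hZX, C, hCl, hCn, hCR, hZ, haZ, hgr⟩ := ih (by omega)
      have hZY : Y ⊆ X \ Z := by
        intro y hy
        refine mem_sdiff.2 ⟨hY hy, fun hyZ => ?_⟩
        obtain ⟨x, hx, c, hc, hxc⟩ := hZ y hyZ
        exact hcon x hx y hy ⟨c, hCn.sublist hc, fun s hs => hCR s (hc.subset hs), by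
          have := hc.length_le; omega, hxc⟩
      obtain ⟨s, hsR, hsQ, hs⟩ := hexp Z hZX haZ (haY.trans (card_le_card hZY)) (Q ∪ C.toFinset) (by
        have h1 := card_union_le Q C.toFinset
        have h2 := C.toFinset_card_le
        omega)
      simp only [mem_union, List.mem_toFinset, not_or] at hsQ
      set Z' := Z ∪ (Z.filter (fun z => z * s ∈ X \ Z)).image (· * s) with hZ'
      have hd : Disjoint Z ((Z.filter (fun z => z * s ∈ X \ Z)).image (· * s)) := by
        rw [Finset.disjoint_left]
        intro z hz hz2
        obtain ⟨y, hy, rfl⟩ := mem_image.1 hz2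
        exact (mem_sdiff.1 (mem_filter.1 hy).2).2 hz
      have hc' : #Z' = #Z + #(Z.filter (fun z => z * s ∈ X \ Z)) := by
        rw [hZ', card_union_of_disjoint hd, card_image_of_injective _ (mul_left_injective s)]
      have hZ'X : Z' ⊆ X := by
        apply union_subset hZX
        intro z hz
        obtain ⟨y, hy, rfl⟩ := mem_image.1 hz
        exact (mem_sdiff.1 (mem_filter.1 hy).2).1
      refine ⟨Z', hZ'X, C ++ [s], by simp [hCl], ?_, ?_, ?_, ?_, ?_⟩
      · rw [List.nodup_append]
        refine ⟨hCn, by simp, ?_⟩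
        intro x hx y hy h
        simp only [List.mem_singleton] at hy
        exact hsQ.2 (by rw [← hy, ← h]; exact hx)
      · intro t ht
        rcases List.mem_append.1 ht with ht | ht
        · exact hCR t ht
        · simp only [List.mem_singleton] at ht; subst ht; exact ⟨hsR, hsQ.1⟩
      · intro z hz
        rcases mem_union.1 hz with hz | hz
        · obtain ⟨x, hx, c, hc, h⟩ := hZ z hz
          exact ⟨x, hx, c, hc.trans (List.sublist_append_left _ _), h⟩
        · obtain ⟨y, hy, rfl⟩ := mem_image.1 hz
          obtain ⟨x, hx, c, hc, h⟩ := hZ y (mem_filter.1 hy).1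
          refine ⟨x, hx, c ++ [s], hc.append (List.Sublist.refl _), ?_⟩
          simp [← h, mul_assoc]
      · omega
      · have e1 : (#(X \ Z):ℝ) = #X - #Z := by
          rw [card_sdiff_of_subset hZX, Nat.cast_sub (card_le_card hZX)]
        have e2 : (#(X \ Z'):ℝ) = #X - #Z' := by
          rw [card_sdiff_of_subset hZ'X, Nat.cast_sub (card_le_card hZ'X)]
        have e3 : (#Z':ℝ) = #Z + #(Z.filter (fun z => z * s ∈ X \ Z)) := by rw [hc']; push_cast; rfl
        have h4 : (#Z':ℝ) ≤ #X := Nat.cast_le.2 (card_le_card hZ'X)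
        rw [e1] at hgr hs
        rw [e2]
        set u : ℝ := (#Z:ℝ)
        set u' : ℝ := (#Z':ℝ)
        set n : ℝ := (#X:ℝ)
        set t : ℝ := (#(Z.filter (fun z => z * s ∈ X \ Z)) : ℝ)
        have ht : 0 ≤ t := Nat.cast_nonneg _
        have hu : 0 ≤ u := Nat.cast_nonneg _
        have hn : 0 ≤ n := Nat.cast_nonneg _
        set A : ℝ := (1 + β) ^ j * a with hA
        have hA0 : 0 ≤ A := by positivity
        rw [pow_succ, show (1 + β) ^ j * (1 + β) * (a:ℝ) * (n - u') = (1 + β) * (A * (n - u')) by rw [hA]; ring]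
        rcases le_total u (n - u) with h | h
        · rw [min_eq_left h] at hs
          have : A * (n - u') ≤ A * (n - u) := by gcongr; linarith
          calc (1 + β) * (A * (n - u')) ≤ (1 + β) * (n * u) :=
                mul_le_mul_of_nonneg_left (this.trans hgr) (by linarith)
            _ = n * (u + β * u) := by ring
            _ ≤ n * u' := by gcongr; linarith
        · rw [min_eq_right h] at hs
          have h5 : n - u' ≤ (1 - β) * (n - u) := by linarith
          have hnu : 0 ≤ n - u := by linarith
          calc (1 + β) * (A * (n - u')) ≤ (1 + β) * (A * ((1 - β) * (n - u))) := by gcongr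
            _ = (1 - β ^ 2) * (A * (n - u)) := by ring
            _ ≤ 1 * (A * (n - u)) := by
                apply mul_le_mul_of_nonneg_right _ (by positivity)
                nlinarith
            _ ≤ n * u := by linarith
            _ ≤ n * u' := by gcongr; linarith
  obtain ⟨Z, hZX, C, hCl, hCn, hCR, hZ, haZ, hgr⟩ := key K le_rfl
  have hZY : Y ⊆ X \ Z := by
    intro y hy
    refine mem_sdiff.2 ⟨hY hy, fun hyZ => ?_⟩
    obtain ⟨x, hx, c, hc, hxc⟩ := hZ y hyZ
    exact hcon x hx y hy ⟨c, hCn.sublist hc, fun s hs => hCR s (hc.subset hs), by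
      have := hc.length_le; omega, hxc⟩
  have h1 : (a:ℝ) ≤ #(X \ Z) := Nat.cast_le.2 (haY.trans (card_le_card hZY))
  have h2 : (#Z:ℝ) ≤ #X := Nat.cast_le.2 (card_le_card hZX)
  have h3 : (1 + β) ^ K * a * a ≤ (1 + β) ^ K * a * (#(X \ Z):ℝ) := by gcongr
  have h4 : (#X:ℝ) * #Z ≤ #X * #X := by gcongr
  nlinarith

/-- cutting a path -/
lemma cut_path (l : ℕ) (hl : 0 < l) : ∀ (k : ℕ) (x : Γ) (w : List Γ), w.length = k →
    ∃ P : Fst Γ, fV P = (x ::ₘ (vl x w : Multiset Γ)) ∧ fC P ≤ (w : Multiset Γ) ∧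
      (∀ p ∈ P, p.2.length < l) ∧ l * P.card ≤ w.length + 1 + l ∧ 1 ≤ P.card := by
  intro k
  induction k using Nat.strong_induction_on with
  | _ k ih =>
    intro x w hw
    by_cases h : w.length < l
    · refine ⟨{(x, w)}, ?_, ?_, ?_, ?_, by simp⟩
      · rw [← Multiset.cons_zero, fV_cons]; simp [fV, fE]
      · rw [← Multiset.cons_zero, fC_cons]; simp [fC, fE]
      · simpa using h
      · simp
    · push Not at h
      obtain ⟨w1, s, w2, rfl, hw1⟩ : ∃ w1 s w2, w = w1 ++ s :: w2 ∧ w1.length = l - 1 := by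
        refine ⟨w.take (l-1), w[l-1], w.drop l, ?_, by simp; omega⟩
        have : w.drop (l - 1) = w[l-1] :: w.drop l := by
          rw [List.drop_eq_getElem_cons (by omega)]; congr; omega
        rw [← this, List.take_append_drop]
      simp only [List.length_append, List.length_cons] at hw h
      obtain ⟨P, h1, h2, h3, h4, h5⟩ := ih w2.length (by omega) (x * w1.prod * s) w2 rfl
      refine ⟨(x, w1) ::ₘ P, ?_, ?_, ?_, ?_, by simp⟩
      · rw [fV_cons, h1, vl_append, vl_cons, ← Multiset.coe_add, ← Multiset.cons_coe]
        simp
      · rw [fC_cons, ← Multiset.coe_add, ← Multiset.cons_coe]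
        exact add_le_add le_rfl (h2.trans (Multiset.le_cons_self _ _))
      · intro p hp
        rcases Multiset.mem_cons.1 hp with rfl | hp
        · simp only; omega
        · exact h3 p hp
      · rw [Multiset.card_cons, mul_add]
        simp only [List.length_append, List.length_cons]
        omega

lemma cut_forest (l : ℕ) (hl : 0 < l) (F : Fst Γ) :
    ∃ P : Fst Γ, fV P = fV F ∧ fC P ≤ fC F ∧
      (∀ p ∈ P, p.2.length < l) ∧ l * P.card ≤ (fV F).card + l * F.card ∧ F.card ≤ P.card := by
  induction F using Multiset.induction_on with
  | empty => exact ⟨0, rfl, le_rfl, by simp, by simp, by simp⟩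
  | cons p F ih =>
    obtain ⟨P, h1, h2, h3, h4, h5⟩ := ih
    obtain ⟨P', h1', h2', h3', h4', h5'⟩ := cut_path l hl _ p.1 p.2 rfl
    refine ⟨P' + P, ?_, ?_, ?_, ?_, ?_⟩
    · rw [fV_add, h1, h1', fV_cons]
    · rw [fC_add, fC_cons]; exact add_le_add h2' h2
    · intro q hq
      rcases Multiset.mem_add.1 hq with hq | hq
      · exact h3' q hq
      · exact h3 q hq
    · rw [Multiset.card_add, fV_cons, Multiset.card_add, Multiset.card_cons, Multiset.card_cons]
      simp only [Multiset.coe_card, vl_length]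
      rw [mul_add, mul_add]; omega
    · rw [Multiset.card_add, Multiset.card_cons]; omega

end


section
variable {Γ : Type} [Group Γ] [Fintype Γ] [DecidableEq Γ]

inductive Ch : List (Γ × List Γ) → List Γ → List Γ → Prop
  | nil : Ch [] [] []
  | single (p : Γ × List Γ) : Ch [p] p.2 []
  | push (p q : Γ × List Γ) (A : List (Γ × List Γ)) (W C c : List Γ) :
      Ch (q :: A) W C → p.1 * p.2.prod * c.prod = q.1 → Ch (p :: q :: A) (p.2 ++ (c ++ W)) (c ++ C)

lemma Ch.tail {p : Γ × List Γ} {A : List (Γ × List Γ)} {W C : List Γ} (h : Ch (p :: A) W C) :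
    ∃ W' C', Ch A W' C' ∧ List.Sublist C' C := by
  cases h with
  | single => exact ⟨[], [], Ch.nil, List.Sublist.refl _⟩
  | push _ q A W C c h1 h2 => exact ⟨W, C, h1, List.sublist_append_right _ _⟩

lemma Ch.drop (i : ℕ) {A : List (Γ × List Γ)} {W C : List Γ} (h : Ch A W C) :
    ∃ W' C', Ch (A.drop i) W' C' ∧ List.Sublist C' C := by
  induction i generalizing A W C with
  | zero => exact ⟨W, C, h, List.Sublist.refl _⟩
  | succ i ih =>
    cases A with
    | nil => exact ⟨[], [], Ch.nil, List.nil_sublist _⟩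
    | cons p A =>
      obtain ⟨W1, C1, h1, h2⟩ := h.tail
      obtain ⟨W2, C2, h3, h4⟩ := ih h1
      exact ⟨W2, C2, h3, h4.trans h2⟩

lemma Ch.perm {A : List (Γ × List Γ)} {W C : List Γ} (h : Ch A W C) :
    (W : Multiset Γ) = fC (A : Fst Γ) + (C : Multiset Γ) := by
  induction h with
  | nil => simp [fC, fE]
  | single p => rw [← Multiset.cons_coe, fC_cons]; simp [fC, fE]
  | push p q A W C c h1 h2 ih =>
    rw [← Multiset.cons_coe, fC_cons, ← Multiset.coe_add, ← Multiset.coe_add, ← Multiset.coe_add, ih]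
    abel

lemma Ch.visit {A : List (Γ × List Γ)} {W C : List Γ} (h : Ch A W C) :
    ∀ p A', A = p :: A' → ∀ v ∈ fV (A : Fst Γ), v ∈ p.1 :: vl p.1 W := by
  induction h with
  | nil => intro p A' h; simp at h
  | single p =>
    intro p' A' h v hv
    simp only [List.cons.injEq] at h
    rw [← h.1]
    rw [← Multiset.cons_coe, fV_cons] at hv
    simpa [fV, fE] using hv
  | push p q A W C c h1 h2 ih =>
    intro p' A' h v hv
    simp only [List.cons.injEq] at h
    rw [← h.1]
    rw [← Multiset.cons_coe, fV_cons, Multiset.mem_add] at hv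
    rw [vl_append, vl_append, h2]
    rcases hv with hv | hv
    · rw [Multiset.cons_coe, Multiset.mem_coe, List.mem_cons] at hv
      rcases hv with hv | hv
      · simp [hv]
      · simp [hv]
    · have := ih q A rfl v hv
      rcases List.mem_cons.1 this with h | h
      · have h3 := end_mem (p.1 * p.2.prod) c
        rw [h2, ← h] at h3
        rcases List.mem_cons.1 h3 with h4 | h4
        · have h5 := end_mem p.1 p.2
          rw [← h4] at h5
          rcases List.mem_cons.1 h5 with h6 | h6
          · simp [h6]
          · simp [h6]
        · simp [h4]
      · simp [h]

lemma starts_le (F : Fst Γ) : F.map (fun p => p.1) ≤ fV F := by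
  unfold fV; exact Multiset.le_add_right _ _

lemma fV_mono {F G : Fst Γ} (h : F ≤ G) : fV F ≤ fV G := by
  obtain ⟨H, rfl⟩ := Multiset.le_iff_exists_add.1 h
  rw [fV_add]; exact Multiset.le_add_right _ _

lemma fC_mono {F G : Fst Γ} (h : F ≤ G) : fC F ≤ fC G := by
  obtain ⟨H, rfl⟩ := Multiset.le_iff_exists_add.1 h
  rw [fC_add]; exact Multiset.le_add_right _ _

/-- a set version of ends or starts -/
lemma card_sel {X T : Finset Γ} {M : ℕ} {P F : Fst Γ} (hP : Good X T M P) (hF : F ≤ P)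
    (f : Γ × List Γ → Γ) (hf : F.map f ≤ fV F) :
    #(F.map f).toFinset = F.card ∧ (F.map f).toFinset ⊆ X := by
  have h1 : F.map f ≤ fV P := hf.trans (fV_mono hF)
  constructor
  · rw [Multiset.toFinset_card_of_nodup (Multiset.nodup_of_le h1 hP.vn), Multiset.card_map]
  · intro v hv
    exact hP.vx v (Multiset.mem_of_le h1 (Multiset.mem_toFinset.1 hv))

lemma dfs_loop {X T R : Finset Γ} {M a K q : ℕ} {P : Fst Γ} (hP : Good X T M P)
    (hq : K * M ≤ q) (hCP : CP X R a K q) : ∀ (k : ℕ) (A : List (Γ × List Γ)) (D Y : Fst Γ)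
    (Q : Finset Γ) (C W : List Γ), 2 * Y.card + A.length ≤ k → Ch A W C → (A : Fst Γ) + D + Y = P →
    C.Nodup → (∀ s ∈ C, s ∈ R ∧ s ∈ Q) → #Q ≤ K * (A.length + D.card) →
    (∀ y ∈ Y, ∀ d ∈ D, ¬ Conn R Q K (y.1 * y.2.prod) d.1) → D.card < a →
    ∃ (A : List (Γ × List Γ)) (W C : List Γ), Ch A W C ∧ (A : Fst Γ) ≤ P ∧ M ≤ A.length + 2 * a ∧ C.Nodup ∧
      (∀ s ∈ C, s ∈ R) ∧ C.length ≤ q := by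
  intro k
  induction k with
  | zero =>
    intro A D Y Q C W hk hCh hsum hCn hCR hQ hno hD
    have hc := congrArg Multiset.card hsum
    simp only [Multiset.card_add, Multiset.coe_card, hP.card] at hc
    refine ⟨A, W, C, hCh, ?_, ?_, hCn, fun s hs => (hCR s hs).1, ?_⟩
    · rw [← hsum, add_assoc]; exact Multiset.le_add_right _ _
    · omega
    · rw [← List.toFinset_card_of_nodup hCn]
      refine le_trans (card_le_card (fun s hs => (hCR s (List.mem_toFinset.1 hs)).2)) (hQ.trans (le_trans ?_ hq))
      gcongr; omega
  | succ k ih =>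
    intro A D Y Q C W hk hCh hsum hCn hCR hQ hno hD
    have hc := congrArg Multiset.card hsum
    simp only [Multiset.card_add, Multiset.coe_card, hP.card] at hc
    have hQq : #Q ≤ q := by
      refine hQ.trans (le_trans ?_ hq)
      gcongr; omega
    by_cases hY : Y.card < a
    · refine ⟨A, W, C, hCh, ?_, ?_, hCn, fun s hs => (hCR s hs).1, ?_⟩
      · rw [← hsum, add_assoc]; exact Multiset.le_add_right _ _
      · omega
      · rw [← List.toFinset_card_of_nodup hCn]
        exact le_trans (card_le_card (fun s hs => (hCR s (List.mem_toFinset.1 hs)).2)) hQq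
    push Not at hY
    cases A with
    | nil =>
      obtain ⟨y, hy⟩ := Multiset.exists_mem_of_ne_zero (s := Y) (by
        intro h; rw [h] at hY; simp at hY; omega)
      obtain ⟨Y', rfl⟩ := Multiset.exists_cons_of_mem hy
      refine ih [y] D Y' Q [] y.2 ?_ (Ch.single y) ?_ (by simp) (by simp) ?_ ?_ hD
      · simp at hk ⊢; omega
      · rw [← hsum]; simp
      · refine hQ.trans ?_
        gcongr; simp
      · intro z hz; exact hno z (Multiset.mem_cons_of_mem hz)
    | cons p A =>
      by_cases hcon : ∃ y ∈ Y, Conn R Q K (y.1 * y.2.prod) p.1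
      · obtain ⟨y, hy, c, hcn, hcR, hcl, hcp⟩ := hcon
        obtain ⟨Y', rfl⟩ := Multiset.exists_cons_of_mem hy
        refine ih (y :: p :: A) D Y' (Q ∪ c.toFinset) (c ++ C) (y.2 ++ (c ++ W)) ?_
          (Ch.push y p A W C c hCh hcp) ?_ ?_ ?_ ?_ ?_ hD
        · simp at hk ⊢; omega
        · rw [← hsum]; simp only [← Multiset.cons_coe, ← Multiset.singleton_add]; abel
        · rw [List.nodup_append]
          refine ⟨hcn, hCn, ?_⟩
          intro x hx z hz h
          subst h
          exact (hcR _ hx).2 (hCR _ hz).2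
        · intro s hs
          rcases List.mem_append.1 hs with hs | hs
          · exact ⟨(hcR s hs).1, by simp [hs]⟩
          · exact ⟨(hCR s hs).1, by simp [(hCR s hs).2]⟩
        · have h1 := card_union_le Q c.toFinset
          have h2 := c.toFinset_card_le
          calc #(Q ∪ c.toFinset) ≤ K * ((p :: A).length + D.card) + K := by omega
            _ = _ := by simp only [List.length_cons]; ring
        · intro z hz d hd hco
          exact hno z (Multiset.mem_cons_of_mem hz) d hd (hco.mono subset_union_left)
      · push Not at hcon
        obtain ⟨W', C', h1, h2⟩ := hCh.tail
        have hno' : ∀ y ∈ Y, ∀ d ∈ p ::ₘ D, ¬ Conn R Q K (y.1 * y.2.prod) d.1 := by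
          intro y hy d hd
          rcases Multiset.mem_cons.1 hd with rfl | hd
          · exact hcon y hy
          · exact hno y hy d hd
        have hsum' : (A : Fst Γ) + (p ::ₘ D) + Y = P := by
          rw [← hsum]; simp only [← Multiset.cons_coe, ← Multiset.singleton_add]; abel
        refine ih A (p ::ₘ D) Y Q C' W' ?_ h1 hsum' ?_ ?_ ?_ hno' ?_
        · simp at hk ⊢; omega
        · exact hCn.sublist h2
        · intro s hs; exact hCR s (h2.subset hs)
        · refine hQ.trans (le_of_eq ?_)
          simp only [List.length_cons, Multiset.card_cons]; ring
        · by_contra hDa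
          push Not at hDa
          have hYP : Y ≤ P := by rw [← hsum]; exact Multiset.le_add_left _ _
          have hDP : p ::ₘ D ≤ P := by
            rw [← hsum', add_right_comm]; exact Multiset.le_add_left _ _
          obtain ⟨y1, y2⟩ := card_sel hP hYP (fun p => p.1 * p.2.prod) (ends_le _)
          obtain ⟨d1, d2⟩ := card_sel hP hDP (fun p => p.1) (starts_le _)
          obtain ⟨x, hx, z, hz, hxz⟩ := hCP _ y2 _ d2 (by omega) (by omega) Q hQq
          obtain ⟨y, hy, rfl⟩ := Multiset.mem_map.1 (Multiset.mem_toFinset.1 hx)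
          obtain ⟨d, hd, rfl⟩ := Multiset.mem_map.1 (Multiset.mem_toFinset.1 hz)
          exact hno' y hy d hd hxz

lemma fV_short' (l : ℕ) (F : Fst Γ) (h : ∀ p ∈ F, p.2.length < l) : (fV F).card ≤ F.card * l := by
  have := fV_short l F.toList (fun p hp => h p (by simpa using hp))
  simpa using this

lemma dfs {X T R : Finset Γ} {M a K q l : ℕ} {P : Fst Γ} (hP : Good X T M P) (hTR : Disjoint T R)
    (hl : ∀ p ∈ P, p.2.length < l) (ha : 0 < a) (h3 : 3 * a ≤ M)
    (hq : K * M ≤ q) (hCP : CP X R a K q) :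
    ∃ G ⊆ X, #X < #G + a ∧ ∀ u ∈ G, ∃ w : List Γ, w.Nodup ∧ (∀ s ∈ w, s ∈ T ∨ s ∈ R) ∧
      (fV P).card ≤ #((vl u w).toFinset ∩ X) + 3 * a * l := by
  classical
  obtain ⟨A, W, C, hCh, hAP, hAM, hCn, hCR, hCl⟩ := dfs_loop hP hq hCP _ [] 0 P ∅ [] [] le_rfl Ch.nil
    (by simp) (by simp) (by simp) (by simp) (by simp) (by simpa using ha)
  have hAa : a ≤ A.length := by omega
  set B : Fst Γ := ((A.take a : List _) : Fst Γ) with hB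
  have hBP : B ≤ P := le_trans (Multiset.coe_le.2 (List.take_sublist _ _).subperm) hAP
  have hBc : B.card = a := by rw [hB, Multiset.coe_card, List.length_take]; omega
  obtain ⟨b1, b2⟩ := card_sel hP hBP (fun p => p.1) (starts_le _)
  set G := X.filter (fun u => ∃ p ∈ B, Conn R C.toFinset K u p.1) with hG
  refine ⟨G, filter_subset _ _, ?_, ?_⟩
  · by_contra hcon
    push Not at hcon
    have h1 : #(X \ G) = #X - #G := card_sdiff_of_subset (filter_subset _ _)
    obtain ⟨x, hx, y, hy, hxy⟩ := hCP (X \ G) sdiff_subset _ b2 (by omega) (by omega) C.toFinset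
      (C.toFinset_card_le.trans hCl)
    obtain ⟨d, hd, rfl⟩ := Multiset.mem_map.1 (Multiset.mem_toFinset.1 hy)
    rw [mem_sdiff] at hx
    exact hx.2 (mem_filter.2 ⟨hx.1, d, hd, hxy⟩)
  · intro u hu
    obtain ⟨huX, p, hp, c, hcn, hcR, hcl, hcp⟩ := mem_filter.1 hu
    rw [hB, Multiset.mem_coe] at hp
    obtain ⟨i, hi, hip⟩ := List.mem_iff_getElem.1 hp
    rw [List.length_take] at hi
    rw [List.getElem_take] at hip
    have hdr : A.drop i = p :: A.drop (i+1) := by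
      rw [List.drop_eq_getElem_cons (by omega), hip]
    obtain ⟨W', C', hCh', hCC⟩ := hCh.drop i
    have hsub : ((A.drop i : List _) : Fst Γ) ≤ P :=
      le_trans (Multiset.coe_le.2 (List.drop_sublist _ _).subperm) hAP
    have hperm := hCh'.perm
    have hfC := fC_mono hsub
    have hmemW : ∀ s ∈ W', s ∈ T ∨ s ∈ C' := by
      intro s hs
      rw [← Multiset.mem_coe, hperm, Multiset.mem_add] at hs
      rcases hs with hs | hs
      · exact Or.inl (hP.ct s (Multiset.mem_of_le hfC hs))
      · exact Or.inr hs
    have hWn : W'.Nodup := by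
      rw [← Multiset.coe_nodup, hperm, Multiset.nodup_add]
      refine ⟨Multiset.nodup_of_le hfC hP.cn, hCn.sublist hCC, ?_⟩
      rw [Multiset.disjoint_left]
      intro s hs hs2
      exact Finset.disjoint_left.1 hTR (hP.ct s (Multiset.mem_of_le hfC hs)) (hCR s (hCC.subset hs2))
    refine ⟨c ++ W', ?_, ?_, ?_⟩
    · rw [List.nodup_append]
      refine ⟨hcn, hWn, ?_⟩
      intro x hx y hy h
      subst h
      rcases hmemW _ hy with h | h
      · exact Finset.disjoint_left.1 hTR h (hcR _ hx).1
      · exact (hcR _ hx).2 (List.mem_toFinset.2 (hCC.subset h))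
    · intro s hs
      rcases List.mem_append.1 hs with hs | hs
      · exact Or.inr (hcR s hs).1
      · rcases hmemW s hs with h | h
        · exact Or.inl h
        · exact Or.inr (hCR s (hCC.subset h))
    · have hvis := hCh'.visit p _ hdr
      have hsubV : (fV ((A.drop i : List _) : Fst Γ)).toFinset ⊆ insert p.1 ((vl u (c ++ W')).toFinset ∩ X) := by
        intro v hv
        rw [Multiset.mem_toFinset] at hv
        have hvX : v ∈ X := hP.vx v (Multiset.mem_of_le (fV_mono hsub) hv)
        rcases List.mem_cons.1 (hvis v hv) with h | h
        · simp [h]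
        · apply mem_insert_of_mem
          rw [vl_append, hcp]
          simp [h, hvX]
      have h5 := card_le_card hsubV
      rw [Multiset.toFinset_card_of_nodup (Multiset.nodup_of_le (fV_mono hsub) hP.vn)] at h5
      have h6 := card_insert_le p.1 ((vl u (c ++ W')).toFinset ∩ X)
      obtain ⟨H, hH⟩ := Multiset.le_iff_exists_add.1 hsub
      have h7 : (fV P).card = (fV ((A.drop i : List _) : Fst Γ)).card + (fV H).card := by
        rw [hH, fV_add, Multiset.card_add]
      have h8 : (fV H).card ≤ H.card * l := fV_short' l H (fun p hp => hl p (by rw [hH]; simp [hp]))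
      have h9 := congrArg Multiset.card hH
      rw [Multiset.card_add, hP.card, Multiset.coe_card, List.length_drop] at h9
      have h10 : H.card + 1 ≤ 3 * a := by omega
      have h11 : (H.card + 1) * l ≤ 3 * a * l := by gcongr
      have h12 : 0 < l := by
        have : 0 < P.card := by rw [hP.card]; omega
        obtain ⟨p, hp⟩ := Multiset.card_pos_iff_exists_mem.1 this
        have := hl p hp; omega
      rw [add_mul] at h11
      omega
end


section
variable {Γ : Type} [Group Γ] [Fintype Γ] [DecidableEq Γ]

lemma eg_eq (R Z Y : Finset Γ) : eg R Z Y = ∑ s ∈ R, (#{z ∈ Z | z * s ∈ Y} : ℝ) := by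
  unfold eg
  have h1 : ∀ z ∈ Z, (∑ y ∈ Y, if z⁻¹ * y ∈ R then (1:ℝ) else 0) = ∑ s ∈ R, if z * s ∈ Y then (1:ℝ) else 0 := by
    intro z _
    rw [Finset.sum_boole, Finset.sum_boole]
    congr 1
    apply Finset.card_bij (fun y _ => z⁻¹ * y)
    · intro y hy; simp at hy ⊢; exact ⟨hy.2, hy.1⟩
    · intro a _ b _ h; simpa using h
    · intro s hs; simp at hs; exact ⟨z * s, by simp [hs], by simp⟩
  rw [sum_congr rfl h1, Finset.sum_comm]
  refine sum_congr rfl fun s _ => ?_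
  rw [Finset.sum_boole]

lemma bd_out (T X Z : Finset Γ) (hZ : Z ⊆ X) : (bd T Z : ℝ) ≤ eg T Z (X \ Z) + bd T X := by
  rw [eg_eq]
  unfold bd
  push_cast
  rw [← Finset.sum_add_distrib]
  refine sum_le_sum fun s _ => ?_
  rw [← Nat.cast_add]
  refine Nat.cast_le.2 (le_trans (card_le_card ?_) (card_union_le _ _))
  intro z hz
  simp only [mem_filter, mem_union, mem_sdiff] at hz ⊢
  by_cases h : z * s ∈ X
  · left; exact ⟨hz.1, h, hz.2⟩
  · right; exact ⟨hZ hz.1, h⟩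

lemma bd_in (T X Y : Finset Γ) (hY : Y ⊆ X) : (bd T Y : ℝ) ≤ eg T (X \ Y) Y + bd T X := by
  rw [eg_eq, bd_inv, bd_inv]
  push_cast
  rw [← Finset.sum_add_distrib]
  refine sum_le_sum fun s _ => ?_
  rw [← Nat.cast_add, ← card_image_of_injective {z ∈ X \ Y | z * s ∈ Y} (mul_left_injective s)]
  refine Nat.cast_le.2 (le_trans (card_le_card ?_) (card_union_le _ _))
  intro z hz
  simp only [mem_filter, mem_union, mem_image, mem_sdiff] at hz ⊢
  by_cases h : z * s⁻¹ ∈ X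
  · left; exact ⟨z * s⁻¹, ⟨⟨h, hz.2⟩, by simpa using hz.1⟩, by simp⟩
  · right; exact ⟨hY hz.1, h⟩

lemma bd_eq' (T Y : Finset Γ) : bd T Y = ∑ y ∈ Y, #{s ∈ T | y * s ∉ Y} := by
  unfold bd
  simp_rw [Finset.card_filter]
  rw [Finset.sum_comm]

lemma bd_small (T Y : Finset Γ) : #Y * #T ≤ bd T Y + #Y * #Y := by
  rw [bd_eq', ← smul_eq_mul, ← smul_eq_mul, ← Finset.sum_const, ← Finset.sum_const, ← Finset.sum_add_distrib]
  refine sum_le_sum fun y _ => ?_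
  have h1 := card_filter_add_card_filter_not (s := T) (fun s => y * s ∈ Y)
  have h2 : #{s ∈ T | y * s ∈ Y} ≤ #Y := by
    rw [← card_image_of_injective _ (mul_right_injective y)]
    apply card_le_card
    intro z hz
    obtain ⟨s, hs, rfl⟩ := mem_image.1 hz
    exact (mem_filter.1 hs).2
  omega

lemma expand_T {T X : Finset Γ} {η β : ℝ} {a : ℕ} (hβ : 0 < β) (hβ1 : β ≤ 1/2)
    (hcl : (bd T X : ℝ) ≤ η * #T * #X)
    (hη : η * #X ≤ β / 2 * a) (ha : 0 < a)
    (hnc : ∀ Z ⊆ X, Z.Nonempty → (#Z:ℝ) + #T / 2 ≤ #X → β * #T * #Z < bd T Z) :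
    ∀ Z ⊆ X, a ≤ #Z → a ≤ #(X \ Z) → β / 2 * #T * min (#Z:ℝ) (#(X \ Z):ℝ) ≤ eg T Z (X \ Z) := by
  intro Z hZX haZ haY
  have e1 : (#(X \ Z):ℝ) = #X - #Z := by
    rw [card_sdiff_of_subset hZX, Nat.cast_sub (card_le_card hZX)]
  have haZ' : (a:ℝ) ≤ #Z := Nat.cast_le.2 haZ
  have haY' : (a:ℝ) ≤ #(X \ Z) := Nat.cast_le.2 haY
  have hT0 : (0:ℝ) ≤ #T := Nat.cast_nonneg _
  have hcl2 : (bd T X : ℝ) ≤ #T * (β / 2 * a) := by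
    calc _ ≤ η * #T * #X := hcl
      _ = #T * (η * #X) := by ring
      _ ≤ _ := mul_le_mul_of_nonneg_left hη hT0
  by_cases h : (#Z:ℝ) + #T / 2 ≤ #X
  · have h1 := hnc Z hZX (card_pos.1 (by omega)) h
    have h2 := bd_out T X Z hZX
    have h3 : β / 2 * #T * min (#Z:ℝ) (#(X \ Z):ℝ) ≤ β / 2 * #T * #Z :=
      mul_le_mul_of_nonneg_left (min_le_left _ _) (by positivity)
    have h4 : #T * (β / 2 * a) ≤ #T * (β / 2 * #Z) := by gcongr
    nlinarith
  · push Not at h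
    have h2 := bd_in T X (X \ Z) sdiff_subset
    rw [Finset.sdiff_sdiff_eq_self hZX] at h2
    have h3 : β / 2 * #T * min (#Z:ℝ) (#(X \ Z):ℝ) ≤ β / 2 * #T * #(X \ Z) :=
      mul_le_mul_of_nonneg_left (min_le_right _ _) (by positivity)
    have h5 : (#(X \ Z):ℝ) * #T ≤ bd T (X \ Z) + #(X \ Z) * #(X \ Z) := by
      exact_mod_cast bd_small T (X \ Z)
    set y : ℝ := (#(X \ Z):ℝ)
    have hy0 : 0 ≤ y := Nat.cast_nonneg _
    have h6 : y * y ≤ y * (#T / 2) := mul_le_mul_of_nonneg_left (by linarith) hy0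
    have h4 : #T * (β / 2 * a) ≤ #T * (β / 2 * y) := by gcongr
    have h7 : β * (#T * y) ≤ 1/2 * (#T * y) := mul_le_mul_of_nonneg_right hβ1 (by positivity)
    nlinarith

lemma expand_R {T X R : Finset Γ} {b κ : ℝ} {a r q0 : ℕ} (hb : 0 < b) (hT : 0 < #T) (ha : 0 < a)
    (hRc : 2 ^ r * #R ≤ #T)
    (hR : ∀ Z1 ⊆ X, ∀ Z2 ⊆ X, eg T Z1 Z2 - 2 ^ r * κ * (#X:ℝ) ^ 2 ≤ 2 ^ r * eg R Z1 Z2)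
    (hκ : 2 ^ r * κ * (#X:ℝ) ^ 2 ≤ b / 2 * #T * a)
    (hq0 : 8 * (q0:ℝ) * 2 ^ r ≤ b * #T)
    (hexp : ∀ Z ⊆ X, a ≤ #Z → a ≤ #(X \ Z) → b * #T * min (#Z:ℝ) (#(X \ Z):ℝ) ≤ eg T Z (X \ Z)) :
    ∀ Z ⊆ X, a ≤ #Z → a ≤ #(X \ Z) → ∀ Q : Finset Γ, #Q ≤ q0 →
      ∃ s ∈ R, s ∉ Q ∧ b / 4 * min (#Z:ℝ) (#(X \ Z):ℝ) ≤ #{z ∈ Z | z * s ∈ X \ Z} := by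
  intro Z hZX haZ haY Q hQ
  by_contra hcon
  push Not at hcon
  have h1 := hexp Z hZX haZ haY
  have h2 := hR Z hZX (X \ Z) sdiff_subset
  set μ : ℝ := min (#Z:ℝ) (#(X \ Z):ℝ) with hμ
  have hμa : (a:ℝ) ≤ μ := le_min (Nat.cast_le.2 haZ) (Nat.cast_le.2 haY)
  have ha' : (0:ℝ) < a := Nat.cast_pos.2 ha
  have hT' : (0:ℝ) < #T := Nat.cast_pos.2 hT
  have hμ0 : 0 < μ := lt_of_lt_of_le ha' hμa
  have h3 : eg R Z (X \ Z) ≤ q0 * μ + #R * (b / 4 * μ) := by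
    rw [eg_eq, ← Finset.sum_filter_add_sum_filter_not R (fun s => s ∈ Q)]
    apply add_le_add
    · calc _ ≤ ∑ s ∈ R.filter (fun s => s ∈ Q), μ := by
            refine sum_le_sum fun s _ => ?_
            apply le_min
            · exact Nat.cast_le.2 (card_filter_le _ _)
            · rw [← card_image_of_injective _ (mul_left_injective s)]
              refine Nat.cast_le.2 (card_le_card ?_)
              intro z hz
              obtain ⟨y, hy, rfl⟩ := mem_image.1 hz
              exact (mem_filter.1 hy).2
        _ = #(R.filter (fun s => s ∈ Q)) * μ := by rw [Finset.sum_const, nsmul_eq_mul]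
        _ ≤ q0 * μ := by
            apply mul_le_mul_of_nonneg_right _ hμ0.le
            refine Nat.cast_le.2 (le_trans (card_le_card ?_) hQ)
            intro s hs; exact (mem_filter.1 hs).2
    · calc _ ≤ ∑ s ∈ R.filter (fun s => ¬ s ∈ Q), b / 4 * μ := by
            refine sum_le_sum fun s hs => ?_
            rw [mem_filter] at hs
            exact (hcon s hs.1 hs.2).le
        _ = #(R.filter (fun s => ¬ s ∈ Q)) * (b / 4 * μ) := by rw [Finset.sum_const, nsmul_eq_mul]
        _ ≤ _ := by
            apply mul_le_mul_of_nonneg_right _ (by positivity)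
            exact Nat.cast_le.2 (card_filter_le _ _)
  have hRc' : (2:ℝ) ^ r * #R ≤ #T := by exact_mod_cast hRc
  have h4 : (2:ℝ) ^ r * eg R Z (X \ Z) ≤ 2 ^ r * (q0 * μ + #R * (b / 4 * μ)) :=
    mul_le_mul_of_nonneg_left h3 (by positivity)
  have h5 : (2:ℝ) ^ r * (q0 * μ + #R * (b / 4 * μ)) = (8 * (q0:ℝ) * 2 ^ r) * (μ / 8) + (2 ^ r * #R) * (b / 4 * μ) := by ring
  have h6 : (8 * (q0:ℝ) * 2 ^ r) * (μ / 8) ≤ b * #T * (μ / 8) := mul_le_mul_of_nonneg_right hq0 (by positivity)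
  have h7 : (2 ^ r * #R) * (b / 4 * μ) ≤ #T * (b / 4 * μ) := mul_le_mul_of_nonneg_right hRc' (by positivity)
  have h8 : b / 2 * #T * a ≤ b / 2 * #T * μ := mul_le_mul_of_nonneg_left hμa (by positivity)
  have h9 : 0 < b * #T * μ := by positivity
  nlinarith

lemma atyp_card {T T1 X : Finset Γ} (hT1 : T1 ⊆ T) (t : ℕ) :
    #{x ∈ X | t < #{s ∈ T1 | x * s ∉ X}} * (t + 1) ≤ bd T X := by
  rw [bd_eq', ← smul_eq_mul, ← Finset.sum_const]
  calc _ ≤ ∑ x ∈ X.filter (fun x => t < #{s ∈ T1 | x * s ∉ X}), #{s ∈ T | x * s ∉ X} := by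
        refine sum_le_sum fun x hx => ?_
        have h1 := (mem_filter.1 hx).2
        have h2 : #{s ∈ T1 | x * s ∉ X} ≤ #{s ∈ T | x * s ∉ X} := card_le_card (filter_subset_filter _ hT1)
        omega
    _ ≤ _ := sum_le_sum_of_subset (filter_subset _ _)

def Concl (e : ℝ) (T X : Finset Γ) : Prop :=
  ∃ G ⊆ X, (#T:ℝ) / 8 ≤ #G ∧ ∀ u ∈ G, ∃ w : List Γ, w.Nodup ∧ (∀ s ∈ w, s ∈ T) ∧
    (1 - e) * #T ≤ #((vl u w).toFinset ∩ X)

/-- combination with discrete parameters -/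
lemma D2core {T X R T1 : Finset Γ} {a K lam l J t : ℕ} (hT1 : T1 ⊆ T) (hRT : R ⊆ T)
    (hdis : Disjoint T1 R) (ha : 0 < a) (hlam : 3 ≤ lam) (hTX : #T1 + lam * a < #X)
    (hat : 4 * #{x ∈ X | t < #{s ∈ T1 | x * s ∉ X}} ≤ lam * a)
    (hl : 4 * #X ≤ l * (lam * a)) (hJ : 2 * J ≤ lam * a)
    (hCP : CP X R a K (K * (2 * (lam * a)))) :
    ∃ m : ℕ, m ≤ #T1 ∧ J * #T1 ≤ (J + 1) * m + J * (t + J * l) ∧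
    ∃ G ⊆ X, #X < #G + a ∧ ∀ u ∈ G, ∃ w : List Γ, w.Nodup ∧ (∀ s ∈ w, s ∈ T) ∧
      m ≤ #((vl u w).toFinset ∩ X) + 3 * a * l := by
  obtain ⟨F, hF, hFm⟩ := forest (lam * a) J t l hTX hat hl hJ
  have hX0 : 0 < #X := by omega
  have hl0 : 0 < l := by
    rcases Nat.eq_zero_or_pos l with h | h
    · subst h; omega
    · exact h
  obtain ⟨P, hV, hC, hPl, hPc, hPc2⟩ := cut_forest l hl0 F
  have hP : Good X T1 P.card P := by
    refine ⟨?_, ?_, ?_, ?_, rfl⟩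
    · rw [hV]; exact hF.vn
    · rw [hV]; exact hF.vx
    · exact Multiset.nodup_of_le hC hF.cn
    · intro c hc; exact hF.ct c (Multiset.mem_of_le hC hc)
  have hVX : (fV F).card ≤ #X := by
    have h0 : fV F ≤ X.val := (Multiset.le_iff_subset hF.vn).2 (fun c hc => hF.vx c hc)
    exact Multiset.card_le_card h0
  rw [hF.card] at hPc hPc2
  have hM : P.card ≤ 2 * (lam * a) := by
    have : l * P.card ≤ l * (2 * (lam * a)) := by
      calc _ ≤ _ := hPc
        _ ≤ l * (lam * a) + l * (lam * a) := by omega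
        _ = _ := by ring
    exact Nat.le_of_mul_le_mul_left this hl0
  have h3 : 3 * a ≤ lam * a := Nat.mul_le_mul_right a hlam
  obtain ⟨G, hGX, hGc, hG⟩ := dfs hP hdis hPl ha (by omega) (Nat.mul_le_mul_left K hM) hCP
  refine ⟨(fC F).card, ?_, hFm, G, hGX, hGc, ?_⟩
  · have h0 : fC F ≤ T1.val := (Multiset.le_iff_subset hF.cn).2 (fun c hc => hF.ct c hc)
    exact Multiset.card_le_card h0
  · intro u hu
    obtain ⟨w, h1, h2, h4⟩ := hG u hu
    refine ⟨w, h1, ?_, ?_⟩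
    · intro s hs
      rcases h2 s hs with h | h
      · exact hT1 h
      · exact hRT h
    · rw [hV, fV_card] at h4; omega

end


lemma pick_k (x A b : ℝ) (hx0 : 0 ≤ x) (hx : x < 1) (hb : 0 < b) : ∃ k : ℕ, A * (2 * k + 1) * x ^ k ≤ b := by
  have h1 := tendsto_self_mul_const_pow_of_lt_one hx0 hx
  have h2 := tendsto_pow_atTop_nhds_zero_of_lt_one hx0 hx
  have h3 : Filter.Tendsto (fun k : ℕ => A * (2 * k + 1) * x ^ k) Filter.atTop (nhds 0) := by
    have := ((h1.const_mul 2).add h2).const_mul A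
    simp only [mul_zero, add_zero] at this
    refine this.congr fun k => ?_
    ring
  have := h3.eventually (eventually_le_nhds hb)
  exact this.exists

set_option maxHeartbeats 4000000 in
theorem D2 (e C β : ℝ) (he : 0 < e) (he1 : e ≤ 1) (hC : 1 ≤ C) (hβ : 0 < β) (hβ1 : β ≤ 1/2) :
    ∃ η : ℝ, 0 < η ∧ ∃ n0 : ℕ, ∀ {Γ : Type} [Group Γ] [Fintype Γ] [DecidableEq Γ] (T X : Finset Γ),
      n0 ≤ #T → X.Nonempty → (#X:ℝ) ≤ C * #T → (bd T X : ℝ) ≤ η * #T * #X →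
      (∀ Z ⊆ X, Z.Nonempty → (#Z:ℝ) + #T / 2 ≤ #X → β * #T * #Z < bd T Z) → Concl e T X := by
  obtain ⟨r, hr⟩ : ∃ r : ℕ, (1/2:ℝ) ^ r < e / 8 := exists_pow_lt_of_lt_one (by positivity) (by norm_num)
  obtain ⟨lam, hlam⟩ := exists_nat_ge (400 * C / e)
  obtain ⟨J, hJ⟩ := exists_nat_ge (100 / e)
  set p2 : ℝ := 2 ^ r with hp2
  have hp0 : 0 < p2 := by positivity
  have hp : 8 ≤ e * p2 := by
    have h1 : (1/2:ℝ) ^ r * p2 = 1 := by rw [hp2, ← mul_pow]; norm_num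
    nlinarith
  set x : ℝ := (1 + β / 8)⁻¹ with hx
  have hx0 : 0 < x := by positivity
  have hx1 : x < 1 := by rw [hx]; exact inv_lt_one_of_one_lt₀ (by linarith)
  obtain ⟨k, hk⟩ := pick_k x (48 * lam * C * p2) (β / 2) hx0.le hx1 (by positivity)
  set γ : ℝ := x ^ k with hγ
  have hγ0 : 0 < γ := by positivity
  have hγ1 : γ ≤ 1 := pow_le_one₀ hx0.le hx1.le
  have hlam0 : 400 * C ≤ lam * e := by rwa [div_le_iff₀ he] at hlam
  have hlam400 : (400:ℝ) ≤ lam := by nlinarith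
  have hJ0 : 100 ≤ J * e := by rwa [div_le_iff₀ he] at hJ
  have hJ100 : (100:ℝ) ≤ J := by nlinarith
  -- consequence: lam * γ * C small
  have hsm : 1536 * (lam * γ * C) ≤ e := by
    have h1 : 48 * lam * C * p2 * (2 * k + 1) * γ = (48 * (lam * γ * C)) * (p2 * (2 * k + 1)) := by ring
    rw [h1] at hk
    have h2 : (48 * (lam * γ * C)) * p2 ≤ β / 2 := by
      refine le_trans ?_ hk
      apply mul_le_mul_of_nonneg_left _ (by positivity)
      have : (0:ℝ) ≤ k := Nat.cast_nonneg k
      nlinarith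
    have h3 : (48 * (lam * γ * C)) * p2 * e ≤ 1/4 * e := by
      apply mul_le_mul_of_nonneg_right _ he.le; linarith
    have h4 : (48 * (lam * γ * C)) * 8 ≤ (48 * (lam * γ * C)) * (e * p2) :=
      mul_le_mul_of_nonneg_left hp (by positivity)
    nlinarith
  set κ : ℝ := β * γ / (4 * C * p2) with hκ
  have hκ0 : 0 < κ := by positivity
  set l : ℕ := ⌈4 / (lam * γ)⌉₊ with hl
  have hlγ : 0 < lam * γ := by positivity
  have hl1 : 4 / (lam * γ) ≤ l := Nat.le_ceil _
  have hl2 : (l:ℝ) < 4 / (lam * γ) + 1 := Nat.ceil_lt_add_one (by positivity)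
  have hκ3 : 0 ≤ 3 / (κ / 2) ^ 4 := by positivity
  obtain ⟨n0, hn0⟩ := exists_nat_ge (2 / γ + 2 * (3 / (κ / 2) ^ 4) + 4 * J / γ + 100 * (J * l) / e + 100 / e + 1)
  refine ⟨e * β * γ / 800, by positivity, n0, ?_⟩
  intro Γ _ _ _ T X hTn hXne hXC hcl hnc
  have hNn0 : (n0:ℝ) ≤ #T := Nat.cast_le.2 hTn
  set N : ℝ := (#T:ℝ) with hN
  set n : ℝ := (#X:ℝ) with hn
  have t1 : 0 ≤ 2 / γ := by positivity
  have t3 : 0 ≤ 4 * J / γ := by positivity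
  have t4 : 0 ≤ 100 * (J * l) / e := by positivity
  have t5 : 0 ≤ 100 / e := by positivity
  have N1 : 2 / γ ≤ N := by linarith
  have N2 : 2 * (3 / (κ / 2) ^ 4) ≤ N := by linarith
  have N3 : 4 * J / γ ≤ N := by linarith
  have N4 : 100 * (J * l) / e ≤ N := by linarith
  have N5 : 100 / e ≤ N := by linarith
  have N6 : 1 ≤ N := by linarith
  rw [div_le_iff₀ hγ0] at N1 N3
  rw [div_le_iff₀ he] at N4 N5
  have hn1 : 0 < n := by rw [hn]; exact Nat.cast_pos.2 (card_pos.2 hXne)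
  have hηe : e * β * γ / 800 ≤ e / 1600 := by
    have h1 : e * (β * γ) ≤ e * (1/2) := by
      apply mul_le_mul_of_nonneg_left _ he.le
      exact le_trans (mul_le_of_le_one_right hβ.le hγ1) hβ1
    linarith only [h1]
  -- lower bound on n
  have hnN : N - e / 1600 * N ≤ n := by
    have h1 : n * N ≤ bd T X + n * n := by rw [hn, hN]; exact_mod_cast bd_small T X
    have h2 : n * N ≤ n * (e / 1600 * N + n) := by
      have h3 : e * β * γ / 800 * N * n ≤ e / 1600 * N * n :=
        mul_le_mul_of_nonneg_right (mul_le_mul_of_nonneg_right hηe (by linarith only [N6])) hn1.le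
      linarith only [h1, h3, hcl]
    have := le_of_mul_le_mul_left h2 hn1
    linarith only [this]
  have heN : e * N ≤ N := mul_le_of_le_one_left (by linarith only [N6]) he1
  have heN0 : 0 < e * N := mul_pos he (by linarith only [N6])
  have hnN2 : N / 2 ≤ n := by linarith only [hnN, heN, N6]
  -- a
  set a : ℕ := ⌈γ * n⌉₊ with ha
  have ha1 : γ * n ≤ a := Nat.le_ceil _
  have ha2 : (a:ℝ) < γ * n + 1 := Nat.ceil_lt_add_one (by positivity)
  have hγn : 1 ≤ γ * n := by
    have := mul_le_mul_of_nonneg_left hnN2 hγ0.le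
    linarith only [this, N1]
  have ha3 : (a:ℝ) ≤ 2 * (γ * n) := by linarith
  have ha0 : 0 < a := Nat.ceil_pos.2 (by positivity)
  have ha0' : (0:ℝ) < a := Nat.cast_pos.2 ha0
  have hγnC : γ * n ≤ γ * (C * N) := mul_le_mul_of_nonneg_left hXC hγ0.le
  have hlamγn : 768 * (lam * a) ≤ e * N := by
    have h1 : lam * (a:ℝ) ≤ lam * (2 * (γ * (C * N))) := by gcongr; linarith only [ha3, hγnC]
    have h2 : 1536 * (lam * γ * C) * N ≤ e * N := mul_le_mul_of_nonneg_right hsm (by linarith only [N6])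
    linarith only [h1, h2]
  have hla : (a:ℝ) * 400 ≤ lam * a := by
    have := mul_le_mul_of_nonneg_right hlam400 ha0'.le
    linarith only [this]
  -- reservoir
  obtain ⟨R, hRT, hRc, hRd⟩ := halving_iter r κ hκ0 T X (by rw [← hn]; linarith only [N2, hnN2])
  have hRc' : p2 * #R ≤ N := by rw [hp2, hN]; exact_mod_cast hRc
  have hRe : (#R:ℝ) ≤ e / 8 * N := by
    have h1 : (8:ℝ) * #R ≤ e * p2 * #R := mul_le_mul_of_nonneg_right hp (Nat.cast_nonneg _)
    have h2 : e * (p2 * #R) ≤ e * N := mul_le_mul_of_nonneg_left hRc' he.le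
    linarith only [h1, h2]
  -- T1
  have hfl : (⌊(1 - e/4) * N⌋₊ : ℝ) ≤ (1 - e / 4) * N := Nat.floor_le (by linarith only [heN, N6])
  have hfl2 : (1 - e / 4) * N - 1 < (⌊(1 - e/4) * N⌋₊ : ℝ) := by
    have := Nat.lt_floor_add_one ((1 - e/4) * N); linarith only [this]
  obtain ⟨T1, hT1, hT1c⟩ := exists_subset_card_eq (s := T \ R) (n := ⌊(1 - e/4) * N⌋₊) (by
    have h1 : (#(T \ R):ℝ) = N - #R := by
      rw [card_sdiff_of_subset hRT, Nat.cast_sub (card_le_card hRT)]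
    have : (⌊(1 - e/4) * N⌋₊ : ℝ) ≤ #(T \ R) := by rw [h1]; linarith only [hfl, hRe, heN0]
    exact_mod_cast this)
  have hT1c' : (#T1:ℝ) = (⌊(1 - e/4) * N⌋₊ : ℝ) := by rw [hT1c]
  have hT1T : T1 ⊆ T := hT1.trans sdiff_subset
  have hdis : Disjoint T1 R := by
    rw [Finset.disjoint_left]; intro s hs; exact (mem_sdiff.1 (hT1 hs)).2
  -- connection property
  set K : ℕ := 2 * k + 1 with hK
  have hCP : CP X R a K (K * (2 * (lam * a))) := by
    apply connect (β := β / 8) (by positivity) (by linarith)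
    · have h1 : (1 + β / 8) ^ K * γ ^ 2 = 1 + β / 8 := by
        have hxx : (1 + β / 8) * x = 1 := by rw [hx]; exact mul_inv_cancel₀ (by positivity)
        have h2 : (1 + β / 8) ^ k * γ = 1 := by rw [hγ, ← mul_pow, hxx, one_pow]
        calc (1 + β / 8) ^ K * γ ^ 2 = (1 + β / 8) * ((1 + β / 8) ^ k * γ) ^ 2 := by
              rw [hK]; ring
          _ = _ := by rw [h2]; ring
      have h2 : (γ * n) ^ 2 ≤ (a:ℝ) ^ 2 := pow_le_pow_left₀ (by positivity) ha1 2
      calc n ^ 2 < (1 + β / 8) * n ^ 2 := by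
            have := mul_pos hβ (pow_pos hn1 2)
            linarith only [this]
        _ = (1 + β / 8) ^ K * (γ * n) ^ 2 := by rw [mul_pow, ← mul_assoc, h1]
        _ ≤ _ := by gcongr
    · have h := expand_R (b := β / 2) (κ := κ) (a := a) (r := r) (q0 := K * (2 * (lam * a)) + K) (T := T) (X := X) (R := R)
        (by positivity) (by have : (0:ℝ) < #T := by rw [← hN]; linarith only [N6]
                            exact_mod_cast this) ha0 hRc hRd ?_ ?_ ?_
      · intro Z hZ h1 h2 Q hQ
        obtain ⟨s, hs1, hs2, hs3⟩ := h Z hZ h1 h2 Q hQ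
        refine ⟨s, hs1, hs2, le_trans (le_of_eq ?_) hs3⟩
        ring
      · rw [← hp2, ← hn, ← hN]
        have h1 : p2 * κ = β * γ / (4 * C) := by rw [hκ]; field_simp
        rw [h1]
        have h2 : n ^ 2 ≤ n * (C * N) := by rw [sq]; exact mul_le_mul_of_nonneg_left hXC hn1.le
        calc β * γ / (4 * C) * n ^ 2 ≤ β * γ / (4 * C) * (n * (C * N)) := by gcongr
          _ = β / 4 * N * (γ * n) := by field_simp
          _ ≤ β / 4 * N * a := by gcongr
          _ = _ := by ring
      · rw [← hp2, ← hN]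
        have h1 : (((K * (2 * (lam * a)) + K : ℕ)) : ℝ) = (2 * k + 1) * (2 * (lam * a) + 1) := by
          rw [hK]; push_cast; ring
        rw [h1]
        have h2 : (1:ℝ) ≤ lam * a := by
          have : (1:ℝ) ≤ a := by exact_mod_cast ha0
          linarith only [this, hla]
        have h3 : 2 * (lam * (a:ℝ)) + 1 ≤ 6 * (lam * (γ * (C * N))) := by
          have : lam * (a:ℝ) ≤ lam * (2 * (γ * (C * N))) := by gcongr; linarith only [ha3, hγnC]
          linarith only [this, h2]
        calc 8 * ((2 * (k:ℝ) + 1) * (2 * (lam * a) + 1)) * p2 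
            ≤ 8 * ((2 * (k:ℝ) + 1) * (6 * (lam * (γ * (C * N))))) * p2 := by gcongr
          _ = (48 * lam * C * p2 * (2 * k + 1) * γ) * N := by ring
          _ ≤ _ := mul_le_mul_of_nonneg_right hk (by linarith only [N6])
      · apply expand_T hβ hβ1 hcl _ ha0 hnc
        rw [← hn]
        have h1 : e * β ≤ 1 * β := mul_le_mul_of_nonneg_right he1 hβ.le
        calc e * β * γ / 800 * n = (e * β) / 800 * (γ * n) := by ring
          _ ≤ β / 2 * (γ * n) := by
              apply mul_le_mul_of_nonneg_right _ (by positivity); linarith only [h1, hβ]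
          _ ≤ _ := by gcongr
  have hlamN : 3 ≤ lam := by
    have : (3:ℝ) ≤ lam := by linarith
    exact_mod_cast this
  obtain ⟨m, hmT, hJm, G, hGX, hGc, hG⟩ := D2core (J := J) (l := l) (t := ⌊e / 100 * N⌋₊) hT1T hRT hdis ha0 hlamN
    (by
      have : (#T1:ℝ) + lam * a < n := by
        rw [hT1c']
        linarith only [hfl, hlamγn, hnN, heN0]
      rw [hn] at this; exact_mod_cast this)
    (by
      have h1 := atyp_card (X := X) hT1T ⌊e / 100 * N⌋₊
      set At := #{x ∈ X | ⌊e / 100 * N⌋₊ < #{s ∈ T1 | x * s ∉ X}}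
      have h2 : (At:ℝ) * ((⌊e / 100 * N⌋₊ : ℝ) + 1) ≤ bd T X := by exact_mod_cast h1
      have h3 := Nat.lt_floor_add_one (e / 100 * N)
      have h4 : (At:ℝ) * (e / 100 * N) ≤ e * β * γ / 800 * N * n := by
        refine le_trans ?_ (h2.trans hcl)
        gcongr
      have h5 : (At:ℝ) * (e / 100 * N) ≤ (β / 8 * (γ * n)) * (e / 100 * N) := by
        refine h4.trans (le_of_eq ?_); ring
      have h6 := le_of_mul_le_mul_right h5 (by positivity)
      have h7 : 4 * (At:ℝ) ≤ lam * a := by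
        have : β * (γ * n) ≤ 1/2 * (γ * n) := mul_le_mul_of_nonneg_right hβ1 (by positivity)
        linarith only [this, h6, ha1, hla, hγn]
      exact_mod_cast h7)
    (by
      have : 4 * n ≤ l * (lam * a) := by
        rw [div_le_iff₀ hlγ] at hl1
        calc 4 * n ≤ l * (lam * γ) * n := mul_le_mul_of_nonneg_right hl1 hn1.le
          _ = l * (lam * (γ * n)) := by ring
          _ ≤ _ := by gcongr
      rw [hn] at this; exact_mod_cast this)
    (by
      have : 2 * (J:ℝ) ≤ lam * a := by
        have := mul_le_mul_of_nonneg_left hnN2 hγ0.le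
        linarith only [this, N3, ha1, hla, ha0']
      exact_mod_cast this)
    hCP
  have hm : (1 - 29 / 100 * e) * N ≤ m := by
    have h1 : (J:ℝ) * #T1 ≤ (J + 1) * m + J * ((⌊e / 100 * N⌋₊ : ℝ) + J * l) := by exact_mod_cast hJm
    have h2 : (⌊e / 100 * N⌋₊ : ℝ) ≤ e / 100 * N := Nat.floor_le (by positivity)
    have h3 : (m:ℝ) ≤ #T1 := Nat.cast_le.2 hmT
    have hmN : (m:ℝ) ≤ N := h3.trans (Nat.cast_le.2 (card_le_card hT1T))
    have h4 : (m:ℝ) ≤ J * (e / 100 * N) := by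
      have := mul_le_mul_of_nonneg_right hJ0 (show 0 ≤ N by linarith only [N6])
      linarith only [this, hmN]
    have h5 : (J:ℝ) * #T1 ≤ J * (m + e / 100 * N + (⌊e / 100 * N⌋₊ : ℝ) + J * l) := by linarith only [h1, h4]
    have h6 := le_of_mul_le_mul_left h5 (by linarith only [hJ100])
    rw [hT1c'] at h6
    linarith only [h6, hfl2, h2, N4, N5, heN0]
  have h3al : 3 * (a:ℝ) * l ≤ e / 10 * N := by
    have h1 : (a:ℝ) * l ≤ a * (4 / (lam * γ) + 1) := mul_le_mul_of_nonneg_left hl2.le ha0'.le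
    have h2 : (a:ℝ) * (4 / (lam * γ)) ≤ 2 * (γ * n) * (4 / (lam * γ)) := by gcongr
    have h3 : 2 * (γ * n) * (4 / (lam * γ)) = 8 * n / lam := by field_simp; ring
    have h4 : 8 * n / lam ≤ e / 50 * N := by
      rw [div_le_iff₀ (by linarith only [hlam400])]
      have : 400 * C * N ≤ lam * e * N := mul_le_mul_of_nonneg_right hlam0 (by linarith only [N6])
      linarith only [this, hXC]
    linarith only [h1, h2, h3, h4, hla, hlamγn, heN0]
  refine ⟨G, hGX, ?_, ?_⟩
  · have : n < #G + a := by rw [hn]; exact_mod_cast hGc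
    rw [← hN]
    linarith only [this, hla, hlamγn, heN, hnN2]
  · intro u hu
    obtain ⟨w, h1, h2, h3⟩ := hG u hu
    refine ⟨w, h1, h2, ?_⟩
    have h4 : (m:ℝ) ≤ #((vl u w).toFinset ∩ X) + 3 * a * l := by exact_mod_cast h3
    rw [← hN]
    linarith only [h4, hm, h3al, heN0]


lemma Concl_mono {Γ : Type} [Group Γ] [Fintype Γ] [DecidableEq Γ] {e : ℝ} {T Z X : Finset Γ} (h : Z ⊆ X)
    (hc : Concl e T Z) : Concl e T X := by
  obtain ⟨G, hG, h1, h2⟩ := hc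
  refine ⟨G, hG.trans h, h1, fun u hu => ?_⟩
  obtain ⟨w, h3, h4, h5⟩ := h2 u hu
  refine ⟨w, h3, h4, h5.trans (Nat.cast_le.2 (card_le_card ?_))⟩
  exact inter_subset_inter_left h

theorem lemD (e : ℝ) (he : 0 < e) (he1 : e ≤ 1) (k : ℕ) :
    ∃ η : ℝ, 0 < η ∧ ∃ n0 : ℕ, ∀ {Γ : Type} [Group Γ] [Fintype Γ] [DecidableEq Γ] (T X : Finset Γ),
      n0 ≤ #T → X.Nonempty → (#X:ℝ) ≤ (k:ℝ) / 2 * #T → (bd T X : ℝ) ≤ η * #T * #X → Concl e T X := by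
  induction k with
  | zero =>
    refine ⟨1, one_pos, 0, ?_⟩
    intro Γ _ _ _ T X _ hX h _
    have : (0:ℝ) < #X := Nat.cast_pos.2 (card_pos.2 hX)
    simp at h
    simp [h] at hX
  | succ k ih =>
    obtain ⟨η, hη, n0, h⟩ := ih
    obtain ⟨η', hη', n1, h'⟩ := D2 e (max 1 (((k + 1 : ℕ):ℝ) / 2)) (min η (1/2)) he he1 (le_max_left _ _)
      (lt_min hη (by norm_num)) (min_le_right _ _)
    refine ⟨η', hη', max n0 n1, ?_⟩
    intro Γ _ _ _ T X hT hX hXC hcl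
    by_cases hc : ∀ Z ⊆ X, Z.Nonempty → (#Z:ℝ) + #T / 2 ≤ #X → min η (1/2) * #T * #Z < bd T Z
    · refine h' T X ((le_max_right _ _).trans hT) hX (hXC.trans ?_) hcl hc
      exact mul_le_mul_of_nonneg_right (le_max_right _ _) (Nat.cast_nonneg _)
    · push Not at hc
      obtain ⟨Z, hZ, hZn, hZc, hZb⟩ := hc
      refine Concl_mono hZ (h T Z ((le_max_left _ _).trans hT) hZn ?_ (hZb.trans ?_))
      · push_cast at hXC
        linarith
      · apply mul_le_mul_of_nonneg_right _ (Nat.cast_nonneg _)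
        exact mul_le_mul_of_nonneg_right (min_le_left _ _) (Nat.cast_nonneg _)


section asm
variable {Γ : Type} [Group Γ] [Fintype Γ] [DecidableEq Γ]

def dst (w : List Γ) : ℕ := #((vl 1 w).toFinset)

lemma dst_append (a b : List Γ) : dst (a ++ b) = #((vl 1 a).toFinset ∪ (vl a.prod b).toFinset) := by
  unfold dst
  rw [vl_append, List.toFinset_append, one_mul]

lemma dst_le (a b : List Γ) : dst a ≤ dst (a ++ b) := by
  rw [dst_append]; exact card_le_card subset_union_left

lemma dst_le_len (a : List Γ) : dst a ≤ a.length := by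
  unfold dst
  exact (List.toFinset_card_le _).trans (by rw [vl_length])

lemma dst_app_le (a b : List Γ) : dst (a ++ b) ≤ dst a + b.length := by
  rw [dst_append]
  refine (card_union_le _ _).trans ?_
  have : #((vl a.prod b).toFinset) ≤ b.length := (List.toFinset_card_le _).trans (by rw [vl_length])
  unfold dst
  omega

lemma complete {S : Finset Γ} {w : List Γ} (hw : w.Nodup) (hS : ∀ s ∈ w, s ∈ S) :
    ∃ L : List Γ, L.Nodup ∧ L.toFinset = S ∧ dst w ≤ dst L := by
  refine ⟨w ++ (S \ w.toFinset).toList, ?_, ?_, dst_le _ _⟩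
  · rw [List.nodup_append']
    refine ⟨hw, nodup_toList _, ?_⟩
    intro s h1 h2
    simp at h2
    exact h2.2 h1
  · ext s
    simp
    exact hS s

def phi (X V : Finset Γ) (p : Γ) : ℝ := ∑ u ∈ X, (#{y ∈ V | u * p⁻¹ * y ∈ X} : ℝ)

lemma phi_nonneg (X V : Finset Γ) (p : Γ) : 0 ≤ phi X V p := sum_nonneg fun _ _ => Nat.cast_nonneg _

lemma phi_sum (X V : Finset Γ) : ∑ p, phi X V p = (#V:ℝ) * (#X:ℝ) * #X := by
  unfold phi
  rw [sum_comm]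
  have : ∀ u ∈ X, ∑ p : Γ, (#{y ∈ V | u * p⁻¹ * y ∈ X} : ℝ) = #V * #X := by
    intro u hu
    have h1 : ∀ p : Γ, (#{y ∈ V | u * p⁻¹ * y ∈ X} : ℝ) = ∑ y ∈ V, if u * p⁻¹ * y ∈ X then (1:ℝ) else 0 := by
      intro p; rw [sum_boole]
    simp_rw [h1]
    rw [sum_comm]
    have h2 : ∀ y ∈ V, ∑ p : Γ, (if u * p⁻¹ * y ∈ X then (1:ℝ) else 0) = #X := by
      intro y hy
      rw [sum_boole]
      congr 1
      refine card_bij (fun p _ => u * p⁻¹ * y) ?_ ?_ ?_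
      · intro p hp; exact (mem_filter.1 hp).2
      · intro p _ q _ h
        simpa using h
      · intro x hx
        refine ⟨y * x⁻¹ * u, ?_, ?_⟩
        · simp [mul_assoc, hx]
        · simp [mul_assoc]
    rw [sum_congr rfl h2, sum_const, nsmul_eq_mul]
  rw [sum_congr rfl this, sum_const, nsmul_eq_mul]
  ring

lemma finish {e B : ℝ} {T X : Finset Γ} {w1 v : List Γ} (hC : Concl e T X) (hT : T.Nonempty)
    (hφ : phi X ((vl 1 w1).toFinset) (w1 ++ v).prod ≤ B) :
    ∃ w : List Γ, w.Nodup ∧ (∀ s ∈ w, s ∈ T) ∧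
      (dst w1 : ℝ) + (1 - e) * #T - 8 * B / #T ≤ dst (w1 ++ v ++ w) := by
  obtain ⟨G, hGX, hGc, hG⟩ := hC
  set V := (vl 1 w1).toFinset with hV
  set p := (w1 ++ v).prod with hp
  have hT0 : (0:ℝ) < #T := Nat.cast_pos.2 (card_pos.2 hT)
  have hG0 : (0:ℝ) < #G := by linarith
  have hGne : G.Nonempty := by
    rw [← card_pos]; exact_mod_cast hG0
  obtain ⟨u, hu, hub⟩ : ∃ u ∈ G, (#{y ∈ V | u * p⁻¹ * y ∈ X} : ℝ) ≤ B / #G := by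
    apply exists_le_of_sum_le hGne
    rw [sum_const, nsmul_eq_mul, mul_div_cancel₀ _ hG0.ne']
    refine le_trans ?_ hφ
    exact sum_le_sum_of_subset_of_nonneg hGX (fun _ _ _ => Nat.cast_nonneg _)
  have hB : 0 ≤ B := (phi_nonneg X V p).trans hφ
  obtain ⟨w, hw1, hw2, hw3⟩ := hG u hu
  refine ⟨w, hw1, hw2, ?_⟩
  have h1 : (B / #G:ℝ) ≤ 8 * B / #T := by
    rw [div_le_div_iff₀ hG0 hT0]
    nlinarith
  set D := (vl u w).toFinset ∩ X with hD
  set E := D.image (fun y => p * u⁻¹ * y) with hE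
  have hEc : #E = #D := card_image_of_injective _ (mul_right_injective _)
  have h2 : V ∪ E ⊆ (vl 1 (w1 ++ v ++ w)).toFinset := by
    rw [vl_append, List.toFinset_append, one_mul, ← hp, vl_append, List.toFinset_append]
    refine union_subset (subset_union_left.trans subset_union_left) (subset_union_right.trans' ?_)
    intro y hy
    obtain ⟨z, hz, rfl⟩ := mem_image.1 hy
    have h3 : vl p w = (vl u w).map (p * u⁻¹ * ·) := by
      rw [← vl_translate]; simp
    rw [h3, List.mem_toFinset, List.mem_map]
    exact ⟨z, List.mem_toFinset.1 (mem_inter.1 hz).1, rfl⟩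
  have h3 : V ∩ E ⊆ {y ∈ V | u * p⁻¹ * y ∈ X} := by
    intro y hy
    obtain ⟨h4, h5⟩ := mem_inter.1 hy
    obtain ⟨z, hz, rfl⟩ := mem_image.1 h5
    refine mem_filter.2 ⟨h4, ?_⟩
    have : u * p⁻¹ * (p * u⁻¹ * z) = z := by group
    rw [this]; exact (mem_inter.1 hz).2
  have h4 := card_union_add_card_inter V E
  have h5 := card_le_card h2
  have h6 := card_le_card h3
  have h7 : #V + #D ≤ dst (w1 ++ v ++ w) + #{y ∈ V | u * p⁻¹ * y ∈ X} := by
    unfold dst; omega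
  have h8 : (#V:ℝ) + #D ≤ dst (w1 ++ v ++ w) + #{y ∈ V | u * p⁻¹ * y ∈ X} := by exact_mod_cast h7
  have h9 : (dst w1 : ℝ) = #V := rfl
  linarith

lemma vchoice {R X V : Finset Γ} {K : ℕ} (hK : 0 < K) (hR : 2 * K * (K+1) ≤ #R) {β : ℝ}
    (hβ : ∀ z, nu R K z ≤ β) (x : Γ) :
    ∃ v : List Γ, v.length ≤ K ∧ v.Nodup ∧ (∀ s ∈ v, s ∈ R) ∧
      phi X V (x * v.prod) ≤ 3 * β * ((#V:ℝ) * #X * #X) := by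
  obtain ⟨w, h1, h2, h3, h4, h5⟩ := block R K hK hR β hβ (phi X V) (phi_nonneg X V) x
  rw [phi_sum] at h5
  by_contra hcon
  push Not at hcon
  have h6 : ∀ y ∈ (vl x w), 3 * β * ((#V:ℝ) * #X * #X) < phi X V y := by
    intro y hy
    obtain ⟨i, hi, rfl⟩ := List.getElem_of_mem hy
    rw [vl_getElem]
    apply hcon
    · rw [List.length_take]; omega
    · exact h2.sublist (List.take_sublist _ _)
    · intro s hs; exact h3 s (List.mem_of_mem_take hs)
  have h7 : ∀ l : List Γ, l ≠ [] → (∀ y ∈ l, 3 * β * ((#V:ℝ) * #X * #X) < phi X V y) →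
      l.length * (3 * β * ((#V:ℝ) * #X * #X)) < (l.map (phi X V)).sum := by
    intro l hl h
    have := List.sum_lt_sum_of_ne_nil hl (fun _ => 3 * β * ((#V:ℝ) * #X * #X)) (phi X V) h
    simpa using this
  have h8 := h7 (vl x w) (by
    intro h0
    have := congrArg List.length h0
    rw [vl_length, h1] at this
    simp at this; omega) h6
  rw [vl_length, h1] at h8
  linarith

lemma extend {R : Finset Γ} {K : ℕ} (hK : 0 < K) (hR : 2 * K * (K+1) ≤ #R) {β α : ℝ}
    (hβ : ∀ z, nu R K z ≤ β) (w0 : List Γ) (hsm : 3 * β * w0.length ≤ α) (hβ0 : 0 ≤ β) :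
    ∃ w : List Γ, w.length = K ∧ w.Nodup ∧ (∀ s ∈ w, s ∈ R) ∧
      (dst w0 : ℝ) + (1 - α) * K ≤ dst (w0 ++ w) := by
  set V := (vl 1 w0).toFinset with hV
  obtain ⟨w, h1, h2, h3, h4, h5⟩ := block R K hK hR β hβ (fun y => if y ∈ V then 1 else 0)
    (fun y => by split_ifs <;> norm_num) w0.prod
  refine ⟨w, h1, h2, h3, ?_⟩
  rw [dst_append, ← hV]
  set W := (vl w0.prod w).toFinset with hW
  have hWc : #W = K := by rw [hW, List.toFinset_card_of_nodup h4, vl_length, h1]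
  have h6 : ((vl w0.prod w).map (fun y => if y ∈ V then (1:ℝ) else 0)).sum = #(V ∩ W) := by
    rw [← List.sum_toFinset _ h4, sum_boole, inter_comm, filter_mem_eq_inter]
  have h7 : ∑ y : Γ, (if y ∈ V then (1:ℝ) else 0) = #V := by
    rw [sum_boole]; simp
  rw [h6, h7] at h5
  have h8 : (#V:ℝ) ≤ w0.length := Nat.cast_le.2 (dst_le_len w0)
  have h9 : (#(V ∩ W) : ℝ) ≤ α * K := by
    refine h5.trans ?_
    have : 3 * β * #V ≤ α := le_trans (mul_le_mul_of_nonneg_left h8 (by positivity)) hsm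
    have := mul_le_mul_of_nonneg_right this (Nat.cast_nonneg (α := ℝ) K)
    linarith
  have h10 : (#(V ∪ W):ℝ) + #(V ∩ W) = #V + K := by
    rw [← hWc]; exact_mod_cast card_union_add_card_inter V W
  have h11 : (dst w0 : ℝ) = #V := rfl
  linarith
end asm


lemma pigeon (t : ℕ → ℕ) (ht : ∀ j, t (j+1) ≤ t j) (J d : ℕ) (hJ : 0 < J) (h0 : t 0 ≤ d) :
    ∃ j < J, J * (t j - t (j+1)) ≤ d := by
  by_contra hcon
  push Not at hcon
  have key : ∀ i ≤ J, i * d + J * t i ≤ J * t 0 ∧ (0 < i → i * d + J * t i < J * t 0) := by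
    intro i
    induction i with
    | zero => intro _; simp
    | succ i ih =>
      intro hi
      have h1 := (ih (by omega)).1
      have h2 := hcon i (by omega)
      have h3 : J * (t i - t (i+1)) + J * t (i+1) = J * t i := by
        rw [← mul_add, Nat.sub_add_cancel (ht i)]
      have h4 : (i+1) * d = i * d + d := by ring
      constructor
      · omega
      · intro _; omega
  have := (key J le_rfl).2 hJ
  have h5 : J * t 0 ≤ J * d := Nat.mul_le_mul_left _ h0
  omega

section stp
variable {Γ : Type} [Group Γ] [Fintype Γ] [DecidableEq Γ]

lemma stepB {S : Finset Γ} {w0 : List Γ} {ε η Cj Cj1 : ℝ} {K t1 : ℕ} (X : Finset Γ)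
    (hε : 0 < ε) (hC : 0 < Cj) (hC1 : 0 < Cj1) (hK : 0 < K) (hd : 0 < #S)
    (hw0 : w0.Nodup) (hw0S : ∀ s ∈ w0, s ∈ S)
    (hX : (#X:ℝ) ≤ Cj * #S)
    (hmin : ∀ t < t1, ∀ Y : Finset Γ, Y.Nonempty → (#Y:ℝ) ≤ Cj1 * #S →
      η * #(S \ (w0.take t).toFinset) * #Y < bd (S \ (w0.take t).toFinset) Y)
    (hesc : ∀ R : Finset Γ, R.Nonempty → (∀ Y : Finset Γ, Y.Nonempty → (#Y:ℝ) ≤ Cj1 * #R → η * #R * #Y < bd R Y) →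
      ∀ z, nu R K z ≤ 2 / (Cj1 * #R))
    (hr : ε / 2 * #S ≤ #(S \ w0.toFinset)) (hKr : 2 * K * (K + 1) ≤ #(S \ w0.toFinset)) :
    ∃ v : List Γ, v.length ≤ K ∧ v.Nodup ∧ (∀ s ∈ v, s ∈ S \ (w0.take (t1 - 1)).toFinset) ∧
      phi X ((vl 1 (w0.take (t1 - 1))).toFinset) (w0.take (t1 - 1) ++ v).prod ≤
        12 * Cj ^ 2 / (Cj1 * ε) * (#S:ℝ) ^ 2 := by
  have hd' : (0:ℝ) < #S := Nat.cast_pos.2 hd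
  rcases Nat.eq_zero_or_pos t1 with rfl | ht1
  · refine ⟨[], by simp, by simp, by simp, ?_⟩
    have : phi X ((vl 1 (w0.take (0 - 1))).toFinset) (w0.take (0 - 1) ++ []).prod = 0 := by
      simp [phi, vl_nil]
    rw [this]; positivity
  · set w := w0.take (t1 - 1) with hw
    set R := S \ w.toFinset with hR
    have hsub : S \ w0.toFinset ⊆ R := by
      apply sdiff_subset_sdiff le_rfl
      intro s hs
      rw [List.mem_toFinset] at hs ⊢
      exact List.mem_of_mem_take hs
    have hRc : (#(S \ w0.toFinset):ℝ) ≤ #R := Nat.cast_le.2 (card_le_card hsub)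
    have hR0 : (0:ℝ) < #R := by
      have : 0 < ε / 2 * #S := by positivity
      linarith
    have hRS : (#R:ℝ) ≤ #S := Nat.cast_le.2 (card_le_card sdiff_subset)
    have hnu := hesc R (by rw [← card_pos]; exact_mod_cast hR0) (by
      intro Y hY hYc
      refine hmin (t1 - 1) (by omega) Y hY (hYc.trans ?_)
      exact mul_le_mul_of_nonneg_left hRS hC1.le)
    obtain ⟨v, h1, h2, h3, h4⟩ := vchoice (X := X) (V := (vl 1 w).toFinset) hK (hKr.trans (card_le_card hsub)) hnu w.prod
    refine ⟨v, h1, h2, h3, ?_⟩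
    rw [List.prod_append]
    refine h4.trans ?_
    have hV : (#((vl 1 w).toFinset):ℝ) ≤ #S := by
      have h5 : w.length ≤ #S := by
        have hn : w.Nodup := hw0.sublist (List.take_sublist _ _)
        rw [← List.toFinset_card_of_nodup hn]
        apply card_le_card
        intro s hs
        exact hw0S s (List.mem_of_mem_take (List.mem_toFinset.1 hs))
      exact Nat.cast_le.2 ((dst_le_len w).trans h5)
    have hb : 2 / (Cj1 * #R) ≤ 2 / (Cj1 * (ε / 2 * #S)) := by
      apply div_le_div_of_nonneg_left (by norm_num) (by positivity)
      exact mul_le_mul_of_nonneg_left (by linarith) hC1.le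
    calc 3 * (2 / (Cj1 * #R)) * ((#((vl 1 w).toFinset):ℝ) * #X * #X) 
        ≤ 3 * (2 / (Cj1 * (ε / 2 * #S))) * ((#S:ℝ) * (Cj * #S) * (Cj * #S)) := by
          gcongr
      _ = _ := by field_simp; ring

lemma conv {S : Finset Γ} {L : List Γ} (hL : L.Nodup) (hS : L.toFinset = S) :
    ∃ σ : Fin S.card → Γ, Function.Injective σ ∧ (∀ i, σ i ∈ S) ∧
        (Set.range (fun t : Fin S.card => ((List.ofFn σ).take (t.1 + 1)).prod)).ncard = dst L := by
  have hc : S.card = L.length := by rw [← hS, List.toFinset_card_of_nodup hL]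
  refine ⟨fun i => L.get (i.cast hc), ?_, ?_, ?_⟩
  · intro i j h
    have := (List.nodup_iff_injective_get.1 hL) h
    simpa using this
  · intro i
    have h : ∀ s ∈ L, s ∈ S := by intro s hs; rw [← hS, List.mem_toFinset]; exact hs
    exact h _ (List.get_mem _ _)
  · have h1 : List.ofFn (fun i : Fin S.card => L.get (i.cast hc)) = L := by
      apply List.ext_getElem
      · simp [hc]
      · intro i h1 h2; simp
    rw [h1]
    unfold dst
    rw [← Set.ncard_coe_finset (vl 1 L).toFinset]
    refine congrArg Set.ncard ?_
    ext y
    simp only [Set.mem_range, mem_coe, List.mem_toFinset]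
    constructor
    · rintro ⟨t, rfl⟩
      have ht : t.1 < (vl 1 L).length := by rw [vl_length, ← hc]; exact t.2
      have := List.getElem_mem ht
      rwa [vl_getElem, one_mul] at this
    · intro hy
      obtain ⟨i, hi, rfl⟩ := List.getElem_of_mem hy
      refine ⟨⟨i, by rw [vl_length, ← hc] at hi; exact hi⟩, ?_⟩
      rw [vl_getElem, one_mul]
end stp


noncomputable def Cs (ε : ℝ) : ℕ → ℝ
  | 0 => 120 / ε ^ 2
  | (j+1) => 3840 / ε ^ 3 * (Cs ε j) ^ 2

lemma Cs_one {ε : ℝ} (hε : 0 < ε) (hε1 : ε ≤ 1) (j : ℕ) : 1 ≤ Cs ε j := by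
  have h2 : ε ^ 2 ≤ 1 := pow_le_one₀ hε.le hε1
  have h3 : ε ^ 3 ≤ 1 := pow_le_one₀ hε.le hε1
  induction j with
  | zero => rw [Cs, le_div_iff₀ (by positivity)]; linarith
  | succ j ih =>
    rw [Cs]
    have h4 : 1 ≤ 3840 / ε ^ 3 := by rw [le_div_iff₀ (by positivity)]; linarith
    have h5 : 1 ≤ Cs ε j ^ 2 := one_le_pow₀ ih
    nlinarith

lemma Cs_step {ε : ℝ} (hε : 0 < ε) (hε1 : ε ≤ 1) (j : ℕ) : Cs ε j ≤ Cs ε (j+1) := by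
  have h3 : ε ^ 3 ≤ 1 := pow_le_one₀ hε.le hε1
  have h := Cs_one hε hε1 j
  rw [Cs]
  have h4 : 1 ≤ 3840 / ε ^ 3 := by rw [le_div_iff₀ (by positivity)]; linarith
  have h5 : Cs ε j ≤ Cs ε j ^ 2 := by nlinarith
  nlinarith

lemma Cs_mono {ε : ℝ} (hε : 0 < ε) (hε1 : ε ≤ 1) : Monotone (Cs ε) :=
  monotone_nat_of_le_succ (Cs_step hε hε1)

set_option maxHeartbeats 1000000 in
theorem main0 (ε : ℝ) (hε : 0 < ε) (hε1 : ε ≤ 1) :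
    ∃ d₀ : ℕ, ∀ (Γ : Type) [Group Γ] [Fintype Γ] [DecidableEq Γ] (S : Finset Γ), d₀ ≤ #S →
      ∃ L : List Γ, L.Nodup ∧ L.toFinset = S ∧ (1 - ε) * #S ≤ dst L := by
  obtain ⟨J, hJ⟩ := exists_nat_ge (10 / ε)
  rw [div_le_iff₀ hε] at hJ
  have hJ0 : 0 < J := by
    rcases Nat.eq_zero_or_pos J with h | h
    · rw [h] at hJ; norm_num at hJ
    · exact h
  obtain ⟨k, hk⟩ := exists_nat_ge (8 * Cs ε J / ε)
  rw [div_le_iff₀ hε] at hk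
  obtain ⟨ηD, hηD, n0, hD⟩ := lemD (ε / 10) (by positivity) (by linarith) k
  set η := min (ηD / 2) 1 with hη
  have hη0 : 0 < η := lt_min (by positivity) one_pos
  have hηD2 : 2 * η ≤ ηD := by
    have := min_le_left (ηD / 2) 1
    linarith
  have hCpos : ∀ j, 0 < Cs ε j := fun j => lt_of_lt_of_le one_pos (Cs_one hε hε1 j)
  choose K hK0 hKe using fun j => escape η (Cs ε j) hη0 (min_le_right _ _) (hCpos j)
  set M := ∑ j ∈ range (J + 1), K j with hM
  have hKM : ∀ j ≤ J, K j ≤ M := fun j hj =>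
    single_le_sum (f := K) (fun _ _ => Nat.zero_le _) (mem_range.2 (by omega))
  obtain ⟨d0, hd0⟩ := exists_nat_ge ((4 * n0 + 10 * (M + 1) + 2 * (2 * M * (M + 1))) / ε)
  rw [div_le_iff₀ hε] at hd0
  refine ⟨d0 + 1, ?_⟩
  intro Γ _ _ _ S hS
  have hd : 0 < #S := by omega
  set d : ℝ := (#S : ℝ) with hdd
  have hd1 : (d0:ℝ) ≤ d := by
    rw [hdd]; exact Nat.cast_le.2 (by omega)
  have hdpos : 0 < d := Nat.cast_pos.2 hd
  have hM0 : (0:ℝ) ≤ M := Nat.cast_nonneg _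
  have hn00 : (0:ℝ) ≤ n0 := Nat.cast_nonneg _
  have hMM : (0:ℝ) ≤ 2 * M * (M + 1) := by positivity
  have hde : 4 * n0 + 10 * ((M:ℝ) + 1) + 2 * (2 * M * (M + 1)) ≤ ε * d := by
    have := mul_le_mul_of_nonneg_right hd1 hε.le
    linarith
  -- longest good word
  have hex : ∃ w0 : List Γ, (w0.Nodup ∧ (∀ s ∈ w0, s ∈ S) ∧ (1 - ε / 10) * w0.length ≤ dst w0) ∧
      ∀ w : List Γ, w.Nodup → (∀ s ∈ w, s ∈ S) → (1 - ε / 10) * w.length ≤ dst w → w.length ≤ w0.length := by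
    have hlen : ∀ w : List Γ, w.Nodup → (∀ s ∈ w, s ∈ S) → w.length ≤ #S := by
      intro w hw hs
      rw [← List.toFinset_card_of_nodup hw]
      exact card_le_card fun s h => hs s (List.mem_toFinset.1 h)
    classical
    let P : ℕ → Prop := fun m => ∃ w : List Γ, w.length = m ∧ w.Nodup ∧ (∀ s ∈ w, s ∈ S) ∧ (1 - ε / 10) * w.length ≤ dst w
    have hP0 : P 0 := ⟨[], rfl, List.nodup_nil, by simp, by simp⟩
    obtain ⟨w0, h1, h2, h3, h4⟩ := Nat.findGreatest_spec (P := P) (Nat.zero_le #S) hP0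
    refine ⟨w0, ⟨h2, h3, h4⟩, ?_⟩
    intro w hw1 hw2 hw3
    rw [h1]
    exact Nat.le_findGreatest (hlen w hw1 hw2) ⟨w, rfl, hw1, hw2, hw3⟩
  obtain ⟨w0, ⟨hw0, hw0S, hw0d⟩, hmax⟩ := hex
  have hw0sub : w0.toFinset ⊆ S := fun s h => hw0S s (List.mem_toFinset.1 h)
  have hw0c : #(w0.toFinset) = w0.length := List.toFinset_card_of_nodup hw0
  have hw0l : w0.length ≤ #S := by rw [← hw0c]; exact card_le_card hw0sub
  have hw0l' : (w0.length:ℝ) ≤ d := Nat.cast_le.2 hw0l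
  have hRc : (#(S \ w0.toFinset):ℝ) = d - w0.length := by
    rw [card_sdiff_of_subset hw0sub, Nat.cast_sub (card_le_card hw0sub), hw0c]
  by_cases hA : (#(S \ w0.toFinset):ℝ) < ε / 2 * d
  · obtain ⟨L, h1, h2, h3⟩ := complete hw0 hw0S
    refine ⟨L, h1, h2, ?_⟩
    have h4 : (dst w0 : ℝ) ≤ dst L := Nat.cast_le.2 h3
    have h5 : ε * w0.length ≤ ε * d := mul_le_mul_of_nonneg_left hw0l' hε.le
    rw [hRc] at hA
    have h6 : 0 < ε * d := by positivity
    have h7 : ε * ε * d ≤ ε * d := by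
      rw [mul_assoc]; exact mul_le_of_le_one_left h6.le hε1
    linarith only [hA, h4, h5, h6, hw0d]
  push Not at hA
  have hKr : ∀ j ≤ J, 2 * K j * (K j + 1) ≤ #(S \ w0.toFinset) := by
    intro j hj
    have h1 : 2 * K j * (K j + 1) ≤ 2 * M * (M + 1) := by
      have := hKM j hj
      gcongr
    have h2 : ((2 * M * (M + 1) : ℕ) : ℝ) ≤ #(S \ w0.toFinset) := by
      push_cast
      linarith only [hA, hde, hM0, hn00, hMM]
    exact h1.trans (by exact_mod_cast h2)
  set cl : ℕ → ℕ → Prop := fun j t => ∃ X : Finset Γ, X.Nonempty ∧ (#X:ℝ) ≤ Cs ε j * d ∧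
    (bd (S \ (w0.take t).toFinset) X : ℝ) ≤ η * #(S \ (w0.take t).toFinset) * #X with hcl
  have hcl0 : cl 0 w0.length := by
    by_contra hcon
    simp only [hcl] at hcon
    push Not at hcon
    rw [List.take_length] at hcon
    have hR0 : (0:ℝ) < #(S \ w0.toFinset) := by
      have : 0 < ε / 2 * d := by positivity
      linarith only [this, hA]
    have hnu := hKe 0 Γ (S \ w0.toFinset) (by rw [← card_pos]; exact_mod_cast hR0) (by
      intro Y hY hYc
      refine hcon Y hY (hYc.trans ?_)
      apply mul_le_mul_of_nonneg_left _ (hCpos 0).le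
      exact Nat.cast_le.2 (card_le_card sdiff_subset))
    have hC0 := hCpos 0
    obtain ⟨w, h1, h2, h3, h4⟩ := extend (α := ε / 10) (hK0 0) (hKr 0 (by omega)) hnu w0 (by
      have : 2 / (Cs ε 0 * #(S \ w0.toFinset)) ≤ 2 / (Cs ε 0 * (ε / 2 * d)) := by
        apply div_le_div_of_nonneg_left (by norm_num) (by positivity)
        exact mul_le_mul_of_nonneg_left hA hC0.le
      calc 3 * (2 / (Cs ε 0 * #(S \ w0.toFinset))) * w0.length 
          ≤ 3 * (2 / (Cs ε 0 * (ε / 2 * d))) * d := by gcongr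
        _ = ε / 10 := by rw [Cs]; field_simp; norm_num) (by positivity)
    have h5 := hmax (w0 ++ w) (by
      rw [List.nodup_append']
      refine ⟨hw0, h2, ?_⟩
      intro s hs1 hs2
      exact (mem_sdiff.1 (h3 s hs2)).2 (List.mem_toFinset.2 hs1)) (by
      intro s hs
      rcases List.mem_append.1 hs with h | h
      · exact hw0S s h
      · exact (mem_sdiff.1 (h3 s h)).1) (by
      rw [List.length_append, h1]; push_cast
      linarith only [h4, hw0d])
    rw [List.length_append, h1] at h5
    have := hK0 0
    omega
  have hclm : ∀ j t, cl j t → cl (j+1) t := by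
    rintro j t ⟨X, h1, h2, h3⟩
    exact ⟨X, h1, h2.trans (mul_le_mul_of_nonneg_right (Cs_step hε hε1 j) hdpos.le), h3⟩
  have hclJ : ∀ j, cl j w0.length := by
    intro j
    induction j with
    | zero => exact hcl0
    | succ j ih => exact hclm _ _ ih
  classical
  have hcle : ∀ j, ∃ t, cl j t := fun j => ⟨_, hclJ j⟩
  set t : ℕ → ℕ := fun j => Nat.find (hcle j) with ht
  have htspec : ∀ j, cl j (t j) := fun j => Nat.find_spec (hcle j)
  have htmin : ∀ j, ∀ i < t j, ¬ cl j i := fun j i hi => Nat.find_min (hcle j) hi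
  have htle : ∀ j, t j ≤ w0.length := fun j => Nat.find_min' (hcle j) (hclJ j)
  have htanti : ∀ j, t (j+1) ≤ t j := fun j => Nat.find_min' (hcle (j+1)) (hclm _ _ (htspec j))
  clear_value t
  obtain ⟨j, hjJ, hjt⟩ := pigeon t htanti J #S hJ0 ((htle 0).trans hw0l)
  obtain ⟨X, hXne, hXc, hXb⟩ := htspec j
  obtain ⟨v, hv1, hv2, hv3, hv4⟩ := stepB (S := S) (w0 := w0) (ε := ε) (η := η) (Cj := Cs ε j) (Cj1 := Cs ε (j+1))
    (K := K (j+1)) (t1 := t (j+1)) X hε (hCpos j) (hCpos (j+1)) (hK0 _) hd hw0 hw0S hXc (by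
      intro i hi Y hY hYc
      by_contra hcon
      push Not at hcon
      exact htmin (j+1) i hi ⟨Y, hY, hYc, hcon⟩) (hKe (j+1) Γ) hA (hKr (j+1) (by omega))
  set w1 := w0.take (t (j+1) - 1) with hw1
  set T0 := S \ (w0.take (t j)).toFinset with hT0
  set T := T0 \ v.toFinset with hT
  have hT0c : (#T0:ℝ) = d - t j := by
    have h1 : (w0.take (t j)).toFinset ⊆ S := fun s hs =>
      hw0S s (List.mem_of_mem_take (List.mem_toFinset.1 hs))
    have h2 : #((w0.take (t j)).toFinset) = t j := by
      rw [List.toFinset_card_of_nodup (hw0.sublist (List.take_sublist _ _)), List.length_take]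
      exact min_eq_left (htle j)
    rw [hT0, card_sdiff_of_subset h1, Nat.cast_sub (card_le_card h1), h2]
  have htj : (t j:ℝ) ≤ w0.length := Nat.cast_le.2 (htle j)
  have hT0ge : ε / 2 * d ≤ #T0 := by rw [hT0c]; rw [hRc] at hA; linarith only [hA, htj]
  have hvM : (v.length:ℝ) ≤ M := Nat.cast_le.2 (hv1.trans (hKM (j+1) (by omega)))
  have hTc : (#T0:ℝ) - M ≤ #T := by
    have h1 : #T0 ≤ #T + #(v.toFinset) := by
      rw [hT]; have := le_card_sdiff v.toFinset T0; omega
    have h2 : #(v.toFinset) ≤ v.length := List.toFinset_card_le _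
    have h3 : (#T0:ℝ) ≤ #T + v.length := by
      have h4 : #T0 ≤ #T + v.length := by omega
      exact_mod_cast h4
    linarith only [h3, hvM]
  have hTge : ε / 4 * d ≤ #T := by linarith only [hTc, hT0ge, hde, hM0, hn00, hMM]
  have hT2 : (#T0:ℝ) ≤ 2 * #T := by linarith only [hTc, hT0ge, hde, hM0, hn00, hMM]
  have hTpos : (0:ℝ) < #T := lt_of_lt_of_le (mul_pos (by linarith only [hε]) hdpos) hTge
  have hTne : T.Nonempty := by rw [← card_pos]; exact_mod_cast hTpos
  have hCon : Concl (ε / 10) T X := by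
    apply hD T X
    · have : (n0:ℝ) ≤ #T := by linarith only [hTge, hde, hM0, hMM]
      exact_mod_cast this
    · exact hXne
    · have h1 : Cs ε j ≤ Cs ε J := Cs_mono hε hε1 hjJ.le
      have h2 : Cs ε j * d ≤ k * ε / 8 * d := mul_le_mul_of_nonneg_right (by linarith only [h1, hk]) hdpos.le
      have h3 : (k:ℝ) / 2 * (ε / 4 * d) ≤ k / 2 * #T := mul_le_mul_of_nonneg_left hTge (div_nonneg (Nat.cast_nonneg _) (by norm_num))
      linarith only [h2, h3, hXc]
    · have h1 : (bd T X:ℝ) ≤ bd T0 X := Nat.cast_le.2 (bd_mono sdiff_subset)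
      refine h1.trans (hXb.trans ?_)
      apply mul_le_mul_of_nonneg_right _ (Nat.cast_nonneg _)
      calc η * (#T0:ℝ) ≤ η * (2 * #T) := mul_le_mul_of_nonneg_left hT2 hη0.le
        _ = 2 * η * #T := by ring
        _ ≤ _ := mul_le_mul_of_nonneg_right hηD2 hTpos.le
  obtain ⟨w, hw1', hw2', hw3'⟩ := finish hCon hTne hv4
  have hw1n : w1.Nodup := hw0.sublist (List.take_sublist _ _)
  have hw1S : ∀ s ∈ w1, s ∈ w0 := fun s hs => List.mem_of_mem_take hs
  have hw1t : ∀ s ∈ w1, s ∈ w0.take (t j) := by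
    intro s hs
    have h1 : t (j+1) - 1 ≤ t j := by have := htanti j; omega
    exact (List.take_sublist_take_left h1).subset hs
  obtain ⟨L, hL1, hL2, hL3⟩ := complete (S := S) (w := w1 ++ v ++ w) (by
      rw [List.nodup_append', List.nodup_append']
      refine ⟨⟨hw1n, hv2, ?_⟩, hw1', ?_⟩
      · intro s h1 h2
        exact (mem_sdiff.1 (hv3 s h2)).2 (List.mem_toFinset.2 h1)
      · intro s h1 h2
        obtain ⟨h3, h4⟩ := mem_sdiff.1 (hw2' s h2)
        rcases List.mem_append.1 h1 with h | h
        · exact (mem_sdiff.1 h3).2 (List.mem_toFinset.2 (hw1t s h))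
        · exact h4 (List.mem_toFinset.2 h)) (by
      intro s hs
      rcases List.mem_append.1 hs with h | h
      · rcases List.mem_append.1 h with h | h
        · exact hw0S s (hw1S s h)
        · exact (mem_sdiff.1 (hv3 s h)).1
      · exact (mem_sdiff.1 (mem_sdiff.1 (hw2' s h)).1).1)
  refine ⟨L, hL1, hL2, ?_⟩
  have e1 : (dst (w1 ++ v ++ w):ℝ) ≤ dst L := Nat.cast_le.2 hL3
  have e2 : (t (j+1):ℝ) - 1 - ε / 10 * d ≤ dst w1 := by
    have h1 := dst_app_le w1 (w0.drop (t (j+1) - 1))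
    rw [hw1, List.take_append_drop, List.length_drop, ← hw1] at h1
    have h2 := htle (j+1)
    have h3 : dst w0 + t (j+1) ≤ dst w1 + w0.length + 1 := by omega
    have h4 : (dst w0:ℝ) + t (j+1) ≤ dst w1 + w0.length + 1 := by exact_mod_cast h3
    have h5 : ε * w0.length ≤ ε * d := mul_le_mul_of_nonneg_left hw0l' hε.le
    linarith only [h4, h5, hw0d]
  have e3 : (t j : ℝ) - t (j+1) ≤ ε / 10 * d := by
    have h1 : (J:ℝ) * ((t j : ℝ) - t (j+1)) ≤ d := by
      rw [← Nat.cast_sub (htanti j), ← Nat.cast_mul]; exact Nat.cast_le.2 hjt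
    have h2 : 0 ≤ (t j : ℝ) - t (j+1) := sub_nonneg.2 (Nat.cast_le.2 (htanti j))
    have h3 := mul_le_mul_of_nonneg_right hJ h2
    have h4 := mul_le_mul_of_nonneg_left h1 hε.le
    linarith only [h3, h4]
  have e4 : 8 * (12 * Cs ε j ^ 2 / (Cs ε (j + 1) * ε) * d ^ 2) / #T ≤ ε / 10 * d := by
    have hCj := hCpos j
    have h1 : 12 * Cs ε j ^ 2 / (Cs ε (j + 1) * ε) * d ^ 2 = ε ^ 2 / 320 * d ^ 2 := by
      rw [Cs]; field_simp; norm_num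
    rw [h1, div_le_iff₀ hTpos]
    have h2 := mul_le_mul_of_nonneg_left hTge (show 0 ≤ ε / 10 * d from mul_nonneg (by linarith only [hε]) hdpos.le)
    refine le_trans (le_of_eq ?_) h2
    ring
  have e5 : ε * #T ≤ ε * d := by
    apply mul_le_mul_of_nonneg_left _ hε.le
    exact Nat.cast_le.2 (card_le_card (sdiff_subset.trans sdiff_subset))
  have e6 : 0 < ε * d := mul_pos hε hdpos
  linarith only [e1, e2, e3, e4, e5, e6, hw3', hTc, hT0c, hde, hM0, hn00, hMM]


end aux

/-- For every `ε > 0` there exists `d₀` such that for every finite group `Γ` and every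
subset `S ⊆ Γ` with `|S| = d ≥ d₀`, there is an ordering `s₁, …, s_d` of `S` whose
partial products `s₁, s₁s₂, …, s₁⋯s_d` take at least `(1-ε)d` distinct values. -/
theorem stmt19 (ε : ℝ) (hε : 0 < ε) :
    ∃ d₀ : ℕ, ∀ (Γ : Type) [Group Γ] [Fintype Γ] (S : Finset Γ), d₀ ≤ S.card →
      ∃ σ : Fin S.card → Γ, Function.Injective σ ∧ (∀ i, σ i ∈ S) ∧
        (1 - ε) * S.card ≤ ((Set.range (partialProd σ)).ncard : ℝ) := by
  classical
  obtain ⟨d₀, h⟩ := main0 (min ε 1) (lt_min hε one_pos) (min_le_right _ _)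
  refine ⟨d₀, ?_⟩
  intro Γ _ _ S hS
  obtain ⟨L, h1, h2, h3⟩ := h Γ S hS
  obtain ⟨σ, h4, h5, h6⟩ := conv h1 h2
  refine ⟨σ, h4, h5, ?_⟩
  have h7 : (Set.range (partialProd σ)).ncard = dst L := h6
  rw [h7]
  refine le_trans ?_ h3
  apply mul_le_mul_of_nonneg_right _ (Nat.cast_nonneg _)
  have := min_le_left ε 1
  linarith
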